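/- Let 1 < p < ∞ and suppose a Banach space E contains a complemented subspace isomorphic to ℓ_p. Then for every natural number n ≥ p, the space P(ⁿE) of continuous n-homogeneous polynomials on E does not have the approximation property. -/

import Mathlib

open scoped ENNReal

noncomputable section

/-- A normed space `E` has the approximation property if for every compact set `K` and `ε > 0`
there is a finite rank bounded operator `T : E → E` with `‖T x - x‖ < ε` on `K`. -/
def HasAP (𝕜 E : Type*) [NontriviallyNormedField 𝕜] [SeminormedAddCommGroup E]
    [NormedSpace 𝕜 E] : Prop :=
  ∀ K : Set E, IsCompact K → ∀ ε : ℝ, 0 < ε →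
    ∃ T : E →L[𝕜] E, FiniteDimensional 𝕜 (LinearMap.range (T : E →ₗ[𝕜] E)) ∧
      ∀ x ∈ K, ‖T x - x‖ < ε

/-- The closed subspace of symmetric continuous `n`-linear maps, our model for the Banach space
`P(ⁿE;F)` of continuous `n`-homogeneous polynomials from `E` to `F` (a polynomial is identified
with its unique symmetric generating multilinear map). -/
def SymmCM (𝕜 : Type*) [NontriviallyNormedField 𝕜] (n : ℕ) (E F : Type*)
    [NormedAddCommGroup E] [NormedSpace 𝕜 E] [NormedAddCommGroup F] [NormedSpace 𝕜 F] :
    Submodule 𝕜 (ContinuousMultilinearMap 𝕜 (fun _ : Fin n => E) F) where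
  carrier := {A | ∀ (σ : Equiv.Perm (Fin n)) (v : Fin n → E), A (v ∘ σ) = A v}
  add_mem' := by intro a b ha hb σ v; simp [ha σ v, hb σ v]
  zero_mem' := by intro σ v; simp
  smul_mem' := by intro c a ha σ v; simp [ha σ v]

/-- The Banach space of continuous `n`-homogeneous polynomials from `E` to `F`. -/
abbrev HomPoly (𝕜 : Type*) [NontriviallyNormedField 𝕜] (n : ℕ) (E F : Type*)
    [NormedAddCommGroup E] [NormedSpace 𝕜 E] [NormedAddCommGroup F] [NormedSpace 𝕜 F] :=
  ↥(SymmCM 𝕜 n E F)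

/-- Evaluation of a homogeneous polynomial on the diagonal. -/
def HomPoly.eval {𝕜 : Type*} [NontriviallyNormedField 𝕜] {n : ℕ} {E F : Type*}
    [NormedAddCommGroup E] [NormedSpace 𝕜 E] [NormedAddCommGroup F] [NormedSpace 𝕜 F]
    (P : HomPoly 𝕜 n E F) (x : E) : F :=
  (P : ContinuousMultilinearMap 𝕜 (fun _ : Fin n => E) F) (fun _ => x)

section A1
variable (𝕜 : Type*) [RCLike 𝕜]

theorem HasAP.of_retract {X Y : Type*} [NormedAddCommGroup X] [NormedSpace 𝕜 X]
    [NormedAddCommGroup Y] [NormedSpace 𝕜 Y] (J : X →L[𝕜] Y) (Q : Y →L[𝕜] X)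
    (h : ∀ x, Q (J x) = x) (hY : HasAP 𝕜 Y) : HasAP 𝕜 X := by
  intro K hK ε hε
  obtain ⟨T, hT, hT2⟩ := hY (J '' K) (hK.image J.continuous) (ε / (‖Q‖ + 1)) (by positivity)
  refine ⟨Q.comp (T.comp J), ?_, ?_⟩
  · have : LinearMap.range ((Q.comp (T.comp J) : X →L[𝕜] X) : X →ₗ[𝕜] X) ≤
        (LinearMap.range (T : Y →ₗ[𝕜] Y)).map (Q : Y →ₗ[𝕜] X) := by
      rintro _ ⟨x, rfl⟩
      exact ⟨T (J x), ⟨J x, rfl⟩, rfl⟩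
    exact Submodule.finiteDimensional_of_le this
  · intro x hx
    have h1 := hT2 (J x) ⟨x, hx, rfl⟩
    have h2 : (Q.comp (T.comp J)) x - x = Q (T (J x) - J x) := by
      simp [h x]
    rw [h2]
    calc ‖Q (T (J x) - J x)‖ ≤ ‖Q‖ * ‖T (J x) - J x‖ := Q.le_opNorm _
      _ ≤ (‖Q‖ + 1) * ‖T (J x) - J x‖ := by gcongr; linarith
      _ < (‖Q‖ + 1) * (ε / (‖Q‖ + 1)) := by gcongr
      _ = ε := by field_simp

abbrev Bil (G : Type) [Fintype G] := EuclideanSpace 𝕜 G →L[𝕜] EuclideanSpace 𝕜 G →L[𝕜] 𝕜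

abbrev XX (G : ℕ → Type) [∀ N, Fintype (G N)] := lp (fun N => Bil 𝕜 (G N)) ∞

instance XX.i1 (G : ℕ → Type) [∀ N, Fintype (G N)] : NormedAddCommGroup (XX 𝕜 G) :=
  lp.normedAddCommGroup
set_option synthInstance.maxHeartbeats 400000 in
set_option maxHeartbeats 1000000 in
instance XX.i2 (G : ℕ → Type) [∀ N, Fintype (G N)] : NormedSpace 𝕜 (XX 𝕜 G) :=
  inferInstance
instance XX.i3 (G : ℕ → Type) [∀ N, Fintype (G N)] : Module 𝕜 (XX 𝕜 G) :=
  (XX.i2 𝕜 G).toModule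

variable {𝕜}

theorem cs_sum {G : Type} [Fintype G] (a b : EuclideanSpace 𝕜 G) :
    ‖∑ h, a h * b h‖ ≤ ‖a‖ * ‖b‖ := by
  calc ‖∑ h, a h * b h‖ ≤ ∑ h, ‖a h‖ * ‖b h‖ := by
        refine (norm_sum_le _ _).trans (le_of_eq ?_)
        simp
    _ ≤ √(∑ h, ‖a h‖ ^ 2) * √(∑ h, ‖b h‖ ^ 2) := Real.sum_mul_le_sqrt_mul_sqrt _ _ _
    _ = _ := by rw [EuclideanSpace.norm_eq, EuclideanSpace.norm_eq]

/-- left translation of a vector -/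
def lt {G : Type} [Fintype G] [Group G] (γ : G) : EuclideanSpace 𝕜 G →ₗ[𝕜] EuclideanSpace 𝕜 G where
  toFun a := WithLp.toLp 2 (fun h => a (γ * h))
  map_add' a b := by ext h; simp
  map_smul' a b := by ext h; simp

@[simp] theorem lt_apply {G : Type} [Fintype G] [Group G] (γ : G) (a : EuclideanSpace 𝕜 G) (h : G) :
    lt γ a h = a (γ * h) := rfl

theorem norm_lt' {G : Type} [Fintype G] [Group G] (γ : G) (a : EuclideanSpace 𝕜 G) :
    ‖lt γ a‖ = ‖a‖ := by
  rw [EuclideanSpace.norm_eq, EuclideanSpace.norm_eq]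
  congr 1
  exact Fintype.sum_equiv (Equiv.mulLeft γ) _ _ (fun h => by simp)

/-- bilinear form attached to a linear map -/
def ofLin {G : Type} [Fintype G] (L : EuclideanSpace 𝕜 G →ₗ[𝕜] EuclideanSpace 𝕜 G) (C : ℝ)
    (hC : ∀ a, ‖L a‖ ≤ C * ‖a‖) : Bil 𝕜 G :=
  LinearMap.mkContinuous₂ (LinearMap.mk₂ 𝕜 (fun a b => ∑ h, L a h * b h)
    (by intro a a' b; simp [add_mul, Finset.sum_add_distrib])
    (by intro c a b; simp [Finset.mul_sum, mul_assoc])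
    (by intro a b b'; simp [mul_add, Finset.sum_add_distrib])
    (by intro c a b; simp [Finset.mul_sum, mul_left_comm])) C
    (by intro a b
        exact (cs_sum _ _).trans (mul_le_mul_of_nonneg_right (hC a) (norm_nonneg _)))

theorem ofLin_apply {G : Type} [Fintype G] (L : EuclideanSpace 𝕜 G →ₗ[𝕜] EuclideanSpace 𝕜 G) (C : ℝ)
    (hC : ∀ a, ‖L a‖ ≤ C * ‖a‖) (a b) : ofLin L C hC a b = ∑ h, L a h * b h := rfl

def ub {G : Type} [Fintype G] [Group G] (γ : G) : Bil 𝕜 G :=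
  ofLin (lt γ) 1 (fun a => by rw [norm_lt', one_mul])

theorem ub_apply {G : Type} [Fintype G] [Group G] (γ : G) (a b : EuclideanSpace 𝕜 G) :
    ub γ a b = ∑ h, a (γ * h) * b h := rfl

theorem bil_norm_le {G : Type} [Fintype G] (x : Bil 𝕜 G) (C : ℝ) (hC : 0 ≤ C)
    (h : ∀ a b, ‖x a b‖ ≤ C * ‖a‖ * ‖b‖) : ‖x‖ ≤ C :=
  ContinuousLinearMap.opNorm_le_bound₂ x hC h

theorem norm_ub_le {G : Type} [Fintype G] [Group G] (γ : G) : ‖(ub γ : Bil 𝕜 G)‖ ≤ 1 :=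
  bil_norm_le _ _ zero_le_one (fun a b => by
    rw [one_mul, ← norm_lt' γ a]; exact cs_sum (lt γ a) b)

theorem bil_apply_le {G : Type} [Fintype G] (x : Bil 𝕜 G) (a b) : ‖x a b‖ ≤ ‖x‖ * ‖a‖ * ‖b‖ :=
  ContinuousLinearMap.le_opNorm₂ x a b

section
variable {Γ : Type} [Group Γ] {G : ℕ → Type} [∀ N, Fintype (G N)] [∀ N, Group (G N)]
  (π : ∀ N, Γ →* G N)

def UU (γ : Γ) : XX 𝕜 G :=
  ⟨fun N => ub (π N γ), memℓp_infty ⟨1, by rintro _ ⟨N, rfl⟩; exact norm_ub_le _⟩⟩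

theorem UU_apply (γ : Γ) (N : ℕ) : (UU (𝕜 := 𝕜) π γ) N = ub (π N γ) := rfl

theorem norm_UU_le (γ : Γ) : ‖UU (𝕜 := 𝕜) π γ‖ ≤ 1 :=
  lp.norm_le_of_forall_le zero_le_one (fun _ => norm_ub_le _)

/-- basis vector -/
def dl {G : Type} [Fintype G] (g : G) : EuclideanSpace 𝕜 G :=
  haveI := Classical.decEq G
  EuclideanSpace.single g 1

theorem dl_apply {G : Type} [Fintype G] (g h : G) [Decidable (h = g)] :
    (dl g : EuclideanSpace 𝕜 G) h = if h = g then 1 else 0 := by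
  simp [dl]

theorem norm_dl {G : Type} [Fintype G] (g : G) : ‖(dl g : EuclideanSpace 𝕜 G)‖ = 1 := by
  simp [dl]

theorem norm_sum_dl {G : Type} [Fintype G] {ι : Type*} [Fintype ι] (q : ι → G)
    (hq : Function.Injective q) (c : ι → 𝕜) :
    ‖∑ i, c i • (dl (q i) : EuclideanSpace 𝕜 G)‖ = √(∑ i, ‖c i‖ ^ 2) := by
  classical
  have ho : Orthonormal 𝕜 (fun i => (dl (q i) : EuclideanSpace 𝕜 G)) := by
    have := (EuclideanSpace.orthonormal_single (𝕜 := 𝕜) (ι := G)).comp q hq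
    convert this using 2 with i
    simp [dl]
  have h2 := ho.inner_sum c c Finset.univ
  rw [@norm_eq_sqrt_re_inner 𝕜, h2]
  congr 1
  rw [map_sum]
  refine Finset.sum_congr rfl (fun i _ => ?_)
  rw [RCLike.conj_mul]
  norm_cast

/-- the coefficient functional -/
def tau {G : Type} [Fintype G] [Group G] (γ : G) (y : Bil 𝕜 G) : 𝕜 :=
  ((Fintype.card G : 𝕜))⁻¹ * ∑ h, y (dl (γ * h)) (dl h)

theorem tau_ub {G : Type} [Fintype G] [Group G] (γ : G) : tau γ (ub γ : Bil 𝕜 G) = 1 := by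
  classical
  have : ∀ h : G, (ub γ : Bil 𝕜 G) (dl (γ * h)) (dl h) = 1 := by
    intro h
    rw [ub_apply]
    simp [dl_apply]
  simp [tau, this]

theorem tau_add {G : Type} [Fintype G] [Group G] (γ : G) (x y : Bil 𝕜 G) :
    tau γ (x + y) = tau γ x + tau γ y := by
  simp [tau, Finset.sum_add_distrib, mul_add]

theorem tau_smul {G : Type} [Fintype G] [Group G] (γ : G) (c : 𝕜) (y : Bil 𝕜 G) :
    tau γ (c • y) = c * tau γ y := by
  simp [tau, Finset.mul_sum, mul_left_comm]

def tauL {G : Type} [Fintype G] [Group G] (γ : G) : Bil 𝕜 G →ₗ[𝕜] 𝕜 where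
  toFun := tau γ
  map_add' := tau_add γ
  map_smul' := tau_smul γ

end
end A1

section A2
variable {𝕜 : Type*} [RCLike 𝕜]

theorem func_bound {G : Type} [Fintype G] [Group G] {B : Type} [AddCommGroup B] [Fintype B]
    (ρ : B → G) (hρ : ∀ a b, ρ (a + b) = ρ a * ρ b) (hinj : Function.Injective ρ) (g g' : G)
    (φ u1 v1 u2 v2 : B → ℝ) (hφ : ∀ k k', φ (k - k') = u1 k * v1 k' + u2 k * v2 k')
    (hb : √(∑ k, u1 k ^ 2) * √(∑ k, v1 k ^ 2) + √(∑ k, u2 k ^ 2) * √(∑ k, v2 k ^ 2) ≤ Fintype.card B)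
    (y : Bil 𝕜 G) : ‖∑ k, (φ k : 𝕜) * tau (g * ρ k * g') y‖ ≤ ‖y‖ := by
  have hG : (0:ℝ) < Fintype.card G := by exact_mod_cast Fintype.card_pos
  have hB : (0:ℝ) < Fintype.card B := by exact_mod_cast Fintype.card_pos
  have hG' : (Fintype.card G : 𝕜) ≠ 0 := by exact_mod_cast hG.ne'
  have hB' : (Fintype.card B : 𝕜) ≠ 0 := by exact_mod_cast hB.ne'
  -- rewriting for a fixed k'
  have key : ∀ k', (Fintype.card G : 𝕜) * ∑ k, (φ k : 𝕜) * tau (g * ρ k * g') y =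
      ∑ h : G, ∑ k, (φ (k - k') : 𝕜) * y (dl (g * ρ k * h)) (dl (g'⁻¹ * ρ k' * h)) := by
    intro k'
    have e1 : (Fintype.card G : 𝕜) * ∑ k, (φ k : 𝕜) * tau (g * ρ k * g') y =
        ∑ h : G, ∑ k, (φ k : 𝕜) * y (dl (g * ρ k * g' * h)) (dl h) := by
      rw [Finset.sum_comm, Finset.mul_sum]
      refine Finset.sum_congr rfl (fun k _ => ?_)
      rw [tau, ← Finset.mul_sum]
      field_simp
    rw [e1]
    symm
    refine Fintype.sum_equiv (Equiv.mulLeft (g'⁻¹ * ρ k')) _ _ (fun h => ?_)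
    refine Fintype.sum_equiv (Equiv.subRight k') _ _ (fun k => ?_)
    have e2 : ρ k = ρ (k - k') * ρ k' := by rw [← hρ]; simp
    simp only [Equiv.subRight_apply, Equiv.coe_mulLeft]
    rw [e2]
    simp [mul_assoc]
  have key2 : (Fintype.card B : 𝕜) * ((Fintype.card G : 𝕜) * ∑ k, (φ k : 𝕜) * tau (g * ρ k * g') y) =
      ∑ h : G, (y (∑ k, (u1 k : 𝕜) • dl (g * ρ k * h)) (∑ k', (v1 k' : 𝕜) • dl (g'⁻¹ * ρ k' * h)) +
        y (∑ k, (u2 k : 𝕜) • dl (g * ρ k * h)) (∑ k', (v2 k' : 𝕜) • dl (g'⁻¹ * ρ k' * h))) := by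
    have : (Fintype.card B : 𝕜) * ((Fintype.card G : 𝕜) * ∑ k, (φ k : 𝕜) * tau (g * ρ k * g') y) =
      ∑ k' : B, ((Fintype.card G : 𝕜) * ∑ k, (φ k : 𝕜) * tau (g * ρ k * g') y) := by
      simp
    rw [this, Finset.sum_congr rfl (fun k' _ => key k'), Finset.sum_comm]
    refine Finset.sum_congr rfl (fun h _ => ?_)
    simp only [map_sum, sum_apply, map_smul, smul_apply,
      smul_eq_mul]
    rw [← Finset.sum_add_distrib]
    refine Finset.sum_congr rfl (fun k' _ => ?_)
    rw [Finset.mul_sum, Finset.mul_sum, ← Finset.sum_add_distrib]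
    refine Finset.sum_congr rfl (fun k _ => ?_)
    rw [hφ]
    push_cast
    ring
  have inj1 : ∀ h, Function.Injective (fun k => g * ρ k * h) := by
    intro h a b hab
    simpa using hinj (by simpa using hab)
  have inj2 : ∀ h, Function.Injective (fun k => g'⁻¹ * ρ k * h) := by
    intro h a b hab
    simpa using hinj (by simpa using hab)
  have hn : ∀ h (u v : B → ℝ), ‖y (∑ k, (u k : 𝕜) • dl (g * ρ k * h))
      (∑ k', (v k' : 𝕜) • dl (g'⁻¹ * ρ k' * h))‖ ≤ ‖y‖ * (√(∑ k, u k ^ 2) * √(∑ k, v k ^ 2)) := by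
    intro h u v
    refine (bil_apply_le _ _ _).trans (le_of_eq ?_)
    rw [norm_sum_dl _ (inj1 h), norm_sum_dl _ (inj2 h), mul_assoc]
    simp
  have tot : ‖(Fintype.card B : 𝕜) * ((Fintype.card G : 𝕜) * ∑ k, (φ k : 𝕜) * tau (g * ρ k * g') y)‖
      ≤ Fintype.card G * (‖y‖ * Fintype.card B) := by
    rw [key2]
    refine (norm_sum_le _ _).trans ?_
    calc _ ≤ ∑ h : G, (‖y‖ * Fintype.card B) := by
          refine Finset.sum_le_sum (fun h _ => ?_)
          refine (norm_add_le _ _).trans ((add_le_add (hn h u1 v1) (hn h u2 v2)).trans ?_)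
          rw [← mul_add]
          gcongr
      _ = _ := by simp
  rw [norm_mul, norm_mul] at tot
  simp only [RCLike.norm_natCast] at tot
  have : (Fintype.card B : ℝ) * Fintype.card G * ‖∑ k, (φ k : 𝕜) * tau (g * ρ k * g') y‖ ≤
    (Fintype.card B : ℝ) * Fintype.card G * ‖y‖ := by linarith
  exact le_of_mul_le_mul_left this (by positivity)

/-- embedding in one of two copies -/
def emb {G : Type} [Fintype G] (t0 : Bool) (a : EuclideanSpace 𝕜 G) : EuclideanSpace 𝕜 (G × Bool) :=
  WithLp.toLp 2 (fun x => if x.2 = t0 then a x.1 else 0)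

theorem emb_apply {G : Type} [Fintype G] (t0 : Bool) (a : EuclideanSpace 𝕜 G) (h : G) (t : Bool) :
  emb t0 a (h, t) = if t = t0 then a h else 0 := rfl

theorem norm_emb {G : Type} [Fintype G] (t0 : Bool) (a : EuclideanSpace 𝕜 G) : ‖emb t0 a‖ = ‖a‖ := by
  rw [EuclideanSpace.norm_eq, EuclideanSpace.norm_eq, Fintype.sum_prod_type]
  congr 1
  refine Finset.sum_congr rfl (fun h _ => ?_)
  cases t0 <;> simp [emb_apply]

/-- twisted translation representation -/
def tw {G : Type} [Fintype G] [Group G] (γ : G) (c s : ℝ) :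
    EuclideanSpace 𝕜 (G × Bool) →ₗ[𝕜] EuclideanSpace 𝕜 (G × Bool) where
  toFun v := WithLp.toLp 2 (fun x => if x.2 = false then
    (c : 𝕜) * v (γ * x.1, false) - (s : 𝕜) * v (γ * x.1, true) else
    (s : 𝕜) * v (γ * x.1, false) + (c : 𝕜) * v (γ * x.1, true))
  map_add' a b := by
    ext ⟨h, t⟩; cases t <;> simp <;> ring
  map_smul' a b := by
    ext ⟨h, t⟩; cases t <;> simp <;> ring

theorem tw_false {G : Type} [Fintype G] [Group G] (γ : G) (c s : ℝ) (v : EuclideanSpace 𝕜 (G × Bool))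
   (h : G) : tw γ c s v (h, false) = (c : 𝕜) * v (γ * h, false) - (s : 𝕜) * v (γ * h, true) := rfl

theorem tw_true {G : Type} [Fintype G] [Group G] (γ : G) (c s : ℝ) (v : EuclideanSpace 𝕜 (G × Bool))
   (h : G) : tw γ c s v (h, true) = (s : 𝕜) * v (γ * h, false) + (c : 𝕜) * v (γ * h, true) := by
  simp [tw]

theorem rot_norm (c s : ℝ) (h : c ^ 2 + s ^ 2 = 1) (a b : 𝕜) :
    ‖(s : 𝕜) * a + (c : 𝕜) * b‖ ^ 2 + ‖(c : 𝕜) * a - (s : 𝕜) * b‖ ^ 2 = ‖b‖ ^ 2 + ‖a‖ ^ 2 := by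
  simp only [← RCLike.normSq_eq_def', RCLike.normSq_apply]
  simp
  linear_combination (RCLike.re a ^ 2 + RCLike.im a ^ 2 + RCLike.re b ^ 2 + RCLike.im b ^ 2) * h

theorem norm_tw {G : Type} [Fintype G] [Group G] (γ : G) (c s : ℝ) (hcs : c ^ 2 + s ^ 2 = 1)
    (v : EuclideanSpace 𝕜 (G × Bool)) : ‖tw γ c s v‖ = ‖v‖ := by
  rw [EuclideanSpace.norm_eq, EuclideanSpace.norm_eq, Fintype.sum_prod_type, Fintype.sum_prod_type]
  congr 1
  refine Fintype.sum_equiv (Equiv.mulLeft γ) _ _ (fun h => ?_)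
  simp only [Fintype.sum_bool, tw_true, tw_false, Equiv.coe_mulLeft]
  exact rot_norm c s hcs _ _

/-- norm bound hypothesis for all isometric representations -/
def RepBound (𝕜 : Type*) [RCLike 𝕜] {B : Type} [AddCommGroup B] {ι : Type*} [Fintype ι]
    (pt : ι → B) (c : ι → ℝ) (κ : ℝ) : Prop :=
  ∀ (K : Type) [Fintype K] (σ : B → EuclideanSpace 𝕜 K →ₗ[𝕜] EuclideanSpace 𝕜 K),
    (∀ a b v, σ (a + b) v = σ a (σ b v)) → (∀ b v, ‖σ b v‖ = ‖v‖) →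
    ∀ v, ‖∑ i, (c i : 𝕜) • σ (pt i) v‖ ≤ κ * ‖v‖

theorem rep_bound {G : Type} [Fintype G] [Group G] {B : Type} [AddCommGroup B]
    (ρ : B → G) (hρ : ∀ a b, ρ (a + b) = ρ a * ρ b) (g g' : G)
    {ι : Type*} [Fintype ι] (pt : ι → B) (c : ι → ℝ) (κ : ℝ)
    (hκ : RepBound 𝕜 pt c κ) (C S : B → ℝ)
    (hC : ∀ a b, C (a + b) = C a * C b - S a * S b)
    (hS : ∀ a b, S (a + b) = S a * C b + C a * S b) (hCS : ∀ a, C a ^ 2 + S a ^ 2 = 1)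
    (φ : B → ℝ) (hφ : φ = C ∨ φ = S) (a b : EuclideanSpace 𝕜 G) :
    ‖∑ i, (c i : 𝕜) * ((φ (pt i) : 𝕜) * ub (g * ρ (pt i) * g') a b)‖ ≤ κ * ‖a‖ * ‖b‖ := by
  have h1 := hκ (G × Bool) (fun b => tw (ρ b) (C b) (S b)) (by
      intro x y v
      have hc : ρ (x + y) = ρ y * ρ x := by rw [add_comm, hρ]
      ext ⟨h, t⟩
      cases t
      · simp only [tw_false, tw_true, hc, hC, hS, mul_assoc]; push_cast; ring
      · simp only [tw_false, tw_true, hc, hC, hS, mul_assoc]; push_cast; ring)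
    (fun b v => norm_tw _ _ _ (hCS b) v) (emb false (lt g a))
  rw [norm_emb, norm_lt'] at h1
  obtain ⟨t0, ht0⟩ : ∃ t0 : Bool, ∀ i h,
      tw (ρ (pt i)) (C (pt i)) (S (pt i)) (emb false (lt g a)) (h, t0) =
      (φ (pt i) : 𝕜) * a (g * (ρ (pt i) * h)) := by
    rcases hφ with rfl | rfl
    · exact ⟨false, fun i h => by simp [tw_false, emb_apply]⟩
    · exact ⟨true, fun i h => by simp [tw_true, emb_apply]⟩
  set w := ∑ i, (c i : 𝕜) • tw (ρ (pt i)) (C (pt i)) (S (pt i)) (emb false (lt g a)) with hw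
  have h2 : ∑ i, (c i : 𝕜) * ((φ (pt i) : 𝕜) * ub (g * ρ (pt i) * g') a b) =
      ∑ x, w x * emb t0 (lt g'⁻¹ b) x := by
    rw [Fintype.sum_prod_type]
    have : ∀ h, ∑ t, w (h, t) * emb t0 (lt g'⁻¹ b) (h, t) = w (h, t0) * b (g'⁻¹ * h) := by
      intro h
      simp [emb_apply]
    simp only [this]
    have hwt : ∀ h, w (h, t0) = ∑ i, (c i : 𝕜) * ((φ (pt i) : 𝕜) * a (g * (ρ (pt i) * h))) := by
      intro h
      rw [hw, WithLp.ofLp_sum, Finset.sum_apply]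
      refine Finset.sum_congr rfl (fun i _ => ?_)
      rw [← ht0]; rfl
    simp only [hwt, Finset.sum_mul]
    rw [Finset.sum_comm]
    refine Finset.sum_congr rfl (fun i _ => ?_)
    rw [ub_apply, Finset.mul_sum, Finset.mul_sum]
    refine Fintype.sum_equiv (Equiv.mulLeft g') _ _ (fun h => ?_)
    simp [mul_assoc]
  rw [h2]
  refine (cs_sum _ _).trans ?_
  rw [norm_emb, norm_lt']
  gcongr

end A2

section A3
variable {𝕜 : Type*} [RCLike 𝕜]

theorem heis {W B S0 S1 : Type} [AddCommGroup W] [Fintype W] [AddCommGroup B]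
    [AddCommGroup S0] [Fintype S0] [AddCommGroup S1] [Fintype S1]
    (j0 : S0 →+ B) (j1 : S1 →+ B) (h k : W → B) (y : W → W →+ B)
    (hh : ∀ e f, h (e + f) = h e + (k f + y f e))
    (h01 : ∀ s0, ∃ s1, j0 s0 = j1 s1)
    (hfull : ∀ f, f ≠ 0 → ∀ s1, ∃ e s0, j1 s1 = y f e + j0 s0) :
    RepBound 𝕜 (fun i : W × (S0 ⊕ S1) => h i.1 + Sum.elim j0 j1 i.2)
      (fun i => Sum.elim (fun _ => (Fintype.card W : ℝ)⁻¹ * (Fintype.card S0 : ℝ)⁻¹)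
        (fun _ => -((Fintype.card W : ℝ)⁻¹ * (Fintype.card S1 : ℝ)⁻¹)) i.2)
      (2 / √(Fintype.card W : ℝ)) := by
  intro K _ σ hσ hiso v
  have hW : (0:ℝ) < Fintype.card W := by exact_mod_cast Fintype.card_pos
  have hS0 : (0:ℝ) < Fintype.card S0 := by exact_mod_cast Fintype.card_pos
  have hS1 : (0:ℝ) < Fintype.card S1 := by exact_mod_cast Fintype.card_pos
  have hS0' : (Fintype.card S0 : 𝕜) ≠ 0 := by exact_mod_cast hS0.ne'
  have hS1' : (Fintype.card S1 : 𝕜) ≠ 0 := by exact_mod_cast hS1.ne'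
  have hcomm : ∀ a b v, σ a (σ b v) = σ b (σ a v) := by
    intro a b v; rw [← hσ, add_comm, hσ]
  have hinner : ∀ a u w, inner 𝕜 (σ a u) (σ a w) = inner 𝕜 u w := by
    intro a u w
    exact (LinearIsometry.mk (σ a) (hiso a)).inner_map_map u w
  set P0 := (Fintype.card S0 : 𝕜)⁻¹ • ∑ s, σ (j0 s) v with hP0
  set P1 := (Fintype.card S1 : 𝕜)⁻¹ • ∑ s, σ (j1 s) v with hP1
  have nP0 : ‖P0‖ ≤ ‖v‖ := by
    rw [hP0, norm_smul, norm_inv, RCLike.norm_natCast]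
    calc _ ≤ (Fintype.card S0 : ℝ)⁻¹ * ∑ s : S0, ‖v‖ := by
          gcongr
          exact (norm_sum_le _ _).trans (Finset.sum_le_sum (fun s _ => (hiso _ _).le))
      _ = ‖v‖ := by simp
  have nP1 : ‖P1‖ ≤ ‖v‖ := by
    rw [hP1, norm_smul, norm_inv, RCLike.norm_natCast]
    calc _ ≤ (Fintype.card S1 : ℝ)⁻¹ * ∑ s : S1, ‖v‖ := by
          gcongr
          exact (norm_sum_le _ _).trans (Finset.sum_le_sum (fun s _ => (hiso _ _).le))
      _ = ‖v‖ := by simp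
  have fP0 : ∀ s, σ (j0 s) P0 = P0 := by
    intro s
    rw [hP0, map_smul, map_sum]
    congr 1
    refine Fintype.sum_equiv (Equiv.addLeft s) _ _ (fun t => ?_)
    simp [hσ]
  have fP1 : ∀ s, σ (j1 s) P1 = P1 := by
    intro s
    rw [hP1, map_smul, map_sum]
    congr 1
    refine Fintype.sum_equiv (Equiv.addLeft s) _ _ (fun t => ?_)
    simp [hσ]
  have sP0 : ∑ s, σ (j1 s) P0 = (Fintype.card S1 : 𝕜) • P1 := by
    have e1 : ∀ s0, ∑ s, σ (j1 s) (σ (j0 s0) v) = (Fintype.card S1 : 𝕜) • P1 := by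
      intro s0
      obtain ⟨s1, hs1⟩ := h01 s0
      rw [hP1, smul_smul, mul_inv_cancel₀ hS1', one_smul]
      refine Fintype.sum_equiv (Equiv.addRight s1) _ _ (fun t => ?_)
      simp [hσ, hs1]
    simp only [hP0, map_smul, map_sum]
    rw [← Finset.smul_sum, Finset.sum_comm, Finset.sum_congr rfl (fun s _ => e1 s)]
    simp only [Finset.sum_const, Finset.card_univ]
    rw [← Nat.cast_smul_eq_nsmul 𝕜, smul_smul, inv_mul_cancel₀ hS0', one_smul]
  set z := P0 - P1 with hz
  have nz : ‖z‖ ≤ 2 * ‖v‖ := by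
    refine (norm_sub_le _ _).trans ?_
    linarith
  have hzero : ∀ f, f ≠ 0 → ∑ e, σ (y f e) z = 0 := by
    intro f hf
    set q := ∑ e, σ (y f e) P0 with hq
    have q1 : ∀ e', σ (y f e') q = q := by
      intro e'
      rw [hq, map_sum]
      refine Fintype.sum_equiv (Equiv.addLeft e') _ _ (fun t => ?_)
      simp [hσ]
    have q2 : ∀ s, σ (j0 s) q = q := by
      intro s
      rw [hq, map_sum]
      refine Finset.sum_congr rfl (fun e _ => ?_)
      rw [hcomm, fP0]
    have q3 : ∀ s, σ (j1 s) q = q := by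
      intro s
      obtain ⟨e, s0, hs⟩ := hfull f hf s
      rw [hs, hσ, q2, q1]
    have q4 : (Fintype.card S1 : 𝕜) • q = (Fintype.card S1 : 𝕜) • (∑ e, σ (y f e) P1) := by
      calc (Fintype.card S1 : 𝕜) • q = ∑ s, σ (j1 s) q := by
            simp [q3, ← Nat.cast_smul_eq_nsmul 𝕜]
        _ = ∑ e, σ (y f e) (∑ s, σ (j1 s) P0) := by
            simp only [hq, map_sum]
            rw [Finset.sum_comm]
            refine Finset.sum_congr rfl (fun e _ => Finset.sum_congr rfl (fun s _ => hcomm _ _ _))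
        _ = _ := by
            simp only [sP0, map_smul]
            rw [← Finset.smul_sum]
    have q5 := smul_right_injective _ hS1' q4
    simp only [hz, map_sub, Finset.sum_sub_distrib]
    rw [← hq, sub_eq_zero]
    exact q5
  have hsum : ∑ i : W × (S0 ⊕ S1), ((Sum.elim (fun _ => (Fintype.card W : ℝ)⁻¹ * (Fintype.card S0 : ℝ)⁻¹)
        (fun _ => -((Fintype.card W : ℝ)⁻¹ * (Fintype.card S1 : ℝ)⁻¹)) i.2 : ℝ) : 𝕜) •
        σ (h i.1 + Sum.elim j0 j1 i.2) v = (Fintype.card W : 𝕜)⁻¹ • ∑ e, σ (h e) z := by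
    rw [Fintype.sum_prod_type, Finset.smul_sum]
    refine Finset.sum_congr rfl (fun e _ => ?_)
    rw [Fintype.sum_sum_type]
    simp only [Sum.elim_inl, Sum.elim_inr, hσ]
    simp only [← Finset.smul_sum, ← map_sum]
    rw [hz, map_sub, hP0, hP1]
    push_cast
    simp only [map_smul]
    module
  rw [hsum]
  have hsq : ‖∑ e, σ (h e) z‖ ^ 2 = Fintype.card W * ‖z‖ ^ 2 := by
    have : inner 𝕜 (∑ e, σ (h e) z) (∑ e, σ (h e) z) = (Fintype.card W : 𝕜) * inner 𝕜 z z := by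
      rw [sum_inner]
      simp only [inner_sum]
      have e1 : ∀ e, ∑ f, inner 𝕜 (σ (h e) z) (σ (h f) z) =
          ∑ f, inner 𝕜 z (σ (k f) (σ (y f e) z)) := by
        intro e
        symm
        refine Fintype.sum_equiv (Equiv.addLeft e) _ _ (fun f => ?_)
        simp only [Equiv.coe_addLeft]
        rw [hh, hσ, hσ, hinner]
      simp only [e1]
      rw [Finset.sum_comm]
      rw [Finset.sum_eq_single 0]
      · have e2 : ∀ e, σ (k 0) (σ (y 0 e) z) = z := by
          intro e
          have e3 : k 0 + y 0 e = 0 := by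
            have := hh e 0
            rw [add_zero] at this
            exact (left_eq_add.mp this)
          rw [← hσ, e3]
          have e4 := hσ 0 0 z
          rw [add_zero] at e4
          have : ‖σ 0 z - z‖ = 0 := by
            rw [← hiso 0, map_sub, ← e4, sub_self, norm_zero]
          exact sub_eq_zero.mp (norm_eq_zero.mp this)
        simp [e2]
      · intro f _ hf
        rw [← inner_sum, ← map_sum, hzero f hf, map_zero, inner_zero_right]
      · simp
    have h2 := congrArg RCLike.re this
    rw [inner_self_eq_norm_sq] at h2
    rw [h2, inner_self_eq_norm_sq_to_K]
    norm_cast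
  have hn : ‖∑ e, σ (h e) z‖ = √(Fintype.card W : ℝ) * ‖z‖ := by
    rw [← Real.sqrt_sq (norm_nonneg (∑ e, σ (h e) z)), hsq, Real.sqrt_mul hW.le,
      Real.sqrt_sq (norm_nonneg _)]
  rw [norm_smul, norm_inv, RCLike.norm_natCast, hn]
  have hs := Real.sq_sqrt hW.le
  have hs0 : 0 < √(Fintype.card W : ℝ) := Real.sqrt_pos.mpr hW
  calc (Fintype.card W : ℝ)⁻¹ * (√(Fintype.card W : ℝ) * ‖z‖) = ‖z‖ / √(Fintype.card W : ℝ) := by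
        field_simp; rw [hs]
    _ ≤ 2 * ‖v‖ / √(Fintype.card W : ℝ) := by gcongr
    _ = _ := by ring

end A3

section A4
variable {𝕜 : Type*} [RCLike 𝕜]
variable {Γ : Type} [Group Γ] {G : ℕ → Type} [∀ N, Fintype (G N)] [∀ N, Group (G N)]

/-- right regular representation on functions -/
def Rop (𝕜 : Type*) [RCLike 𝕜] {Γ : Type} [Group Γ] : Γ →* Module.End 𝕜 (Γ → 𝕜) where
  toFun γ :=
    { toFun := fun f x => f (x * γ)
      map_add' := fun _ _ => rfl
      map_smul' := fun _ _ => rfl }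
  map_one' := by ext; simp
  map_mul' a b := by ext; simp [mul_assoc]

theorem Rop_apply (γ : Γ) (f : Γ → 𝕜) (x : Γ) : Rop 𝕜 γ f x = f (x * γ) := rfl

def ff (π : ∀ N, Γ →* G N) (N : ℕ) (S : XX 𝕜 G →ₗ[𝕜] XX 𝕜 G) (γ : Γ) : 𝕜 :=
  tau (π N γ) ((S (UU π γ)) N)

def SmallM (π : ∀ N, Γ →* G N) (r M : ℝ) (μ : Module.End 𝕜 (Γ → 𝕜)) : Prop :=
  ∀ g g' : Γ, ∃ F : Set (XX 𝕜 G), F.Finite ∧ (∀ x ∈ F, ‖x‖ ≤ r) ∧ ∀ᶠ N in Filter.atTop,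
    ∀ (S : XX 𝕜 G →ₗ[𝕜] XX 𝕜 G) (δ : ℝ), 0 ≤ δ → (∀ x ∈ F, ‖S x‖ ≤ δ) →
      ‖μ (Rop 𝕜 g' (ff π N S)) g‖ ≤ M * δ

variable {π : ∀ N, Γ →* G N}

theorem SmallM.zero {r : ℝ} : SmallM π r 0 (0 : Module.End 𝕜 (Γ → 𝕜)) := by
  intro g g'
  refine ⟨∅, Set.finite_empty, by simp, Filter.Eventually.of_forall (fun N S δ hδ _ => by simp)⟩

theorem SmallM.add {r M M' : ℝ} {μ ν : Module.End 𝕜 (Γ → 𝕜)} (h1 : SmallM π r M μ)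
    (h2 : SmallM π r M' ν) : SmallM π r (M + M') (μ + ν) := by
  intro g g'
  obtain ⟨F, hF, hr, hE⟩ := h1 g g'
  obtain ⟨F', hF', hr', hE'⟩ := h2 g g'
  refine ⟨F ∪ F', hF.union hF', ?_, ?_⟩
  · rintro x (hx | hx)
    exacts [hr x hx, hr' x hx]
  · filter_upwards [hE, hE'] with N a b S δ hδ hS
    have a1 := a S δ hδ (fun x hx => hS x (Or.inl hx))
    have b1 := b S δ hδ (fun x hx => hS x (Or.inr hx))
    calc _ ≤ _ := norm_add_le _ _
      _ ≤ M * δ + M' * δ := add_le_add a1 b1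
      _ = _ := by ring

theorem SmallM.neg {r M : ℝ} {μ : Module.End 𝕜 (Γ → 𝕜)} (h1 : SmallM π r M μ) :
    SmallM π r M (-μ) := by
  intro g g'
  obtain ⟨F, hF, hr, hE⟩ := h1 g g'
  refine ⟨F, hF, hr, ?_⟩
  filter_upwards [hE] with N a S δ hδ hS
  have := a S δ hδ hS
  simpa using this

theorem SmallM.mono {r r' M M' : ℝ} {μ : Module.End 𝕜 (Γ → 𝕜)} (h1 : SmallM π r M μ)
    (hr : r ≤ r') (hM : M ≤ M') : SmallM π r' M' μ := by
  intro g g'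
  obtain ⟨F, hF, hr, hE⟩ := h1 g g'
  refine ⟨F, hF, fun x hx => (hr x hx).trans (by assumption), ?_⟩
  filter_upwards [hE] with N a S δ hδ hS
  exact (a S δ hδ hS).trans (by gcongr)

/-- uniform averages -/
def IsAvg (ν : Module.End 𝕜 (Γ → 𝕜)) : Prop :=
  ∃ (ι : Type) (_ : Fintype ι) (_ : Nonempty ι) (g : ι → Γ),
    ν = (Fintype.card ι : 𝕜)⁻¹ • ∑ i, Rop 𝕜 (g i)

theorem IsAvg.mul {ν ν' : Module.End 𝕜 (Γ → 𝕜)} (h : IsAvg ν) (h' : IsAvg ν') :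
    IsAvg (ν * ν') := by
  obtain ⟨ι, _, _, g, rfl⟩ := h
  obtain ⟨ι', _, _, g', rfl⟩ := h'
  refine ⟨ι × ι', inferInstance, inferInstance, fun i => g i.1 * g' i.2, ?_⟩
  rw [smul_mul_smul_comm, Finset.sum_mul_sum, Fintype.sum_prod_type, Fintype.card_prod]
  simp [mul_comm]

theorem IsAvg.one : IsAvg (1 : Module.End 𝕜 (Γ → 𝕜)) :=
  ⟨Unit, inferInstance, inferInstance, fun _ => 1, by simp⟩

theorem norm_avg_le {ι : Type} [Fintype ι] [Nonempty ι] (x : ι → 𝕜) (C : ℝ)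
    (h : ∀ i, ‖x i‖ ≤ C) : ‖(Fintype.card ι : 𝕜)⁻¹ * ∑ i, x i‖ ≤ C := by
  have hc : (0:ℝ) < Fintype.card ι := by exact_mod_cast Fintype.card_pos
  rw [norm_mul, norm_inv, RCLike.norm_natCast, inv_mul_le_iff₀ hc]
  refine (norm_sum_le _ _).trans ((Finset.sum_le_sum (fun i _ => h i)).trans ?_)
  simp

theorem SmallM.avg_mul {r M : ℝ} {μ ν : Module.End 𝕜 (Γ → 𝕜)} (hν : IsAvg ν)
    (h : SmallM π r M μ) : SmallM π r M (ν * μ) := by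
  obtain ⟨ι, _, _, q, rfl⟩ := hν
  intro g g'
  choose F hF hr hE using fun i => h (g * q i) g'
  refine ⟨⋃ i, F i, Set.finite_iUnion hF, ?_, ?_⟩
  · intro x hx
    obtain ⟨i, hi⟩ := Set.mem_iUnion.mp hx
    exact hr i x hi
  · filter_upwards [Filter.eventually_all.mpr hE] with N a S δ hδ hS
    have := norm_avg_le (fun i => μ (Rop 𝕜 g' (ff π N S)) (g * q i)) (M * δ)
      (fun i => a i S δ hδ (fun x hx => hS x (Set.mem_iUnion.mpr ⟨i, hx⟩)))
    convert this using 2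
    simp [Module.End.mul_apply, Rop_apply]

theorem SmallM.mul_avg {r M : ℝ} {μ ν : Module.End 𝕜 (Γ → 𝕜)} (h : SmallM π r M μ)
    (hν : IsAvg ν) : SmallM π r M (μ * ν) := by
  obtain ⟨ι, _, _, q, rfl⟩ := hν
  intro g g'
  choose F hF hr hE using fun i => h g (q i * g')
  refine ⟨⋃ i, F i, Set.finite_iUnion hF, ?_, ?_⟩
  · intro x hx
    obtain ⟨i, hi⟩ := Set.mem_iUnion.mp hx
    exact hr i x hi
  · filter_upwards [Filter.eventually_all.mpr hE] with N a S δ hδ hS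
    have := norm_avg_le (fun i => μ (Rop 𝕜 (q i * g') (ff π N S)) g) (M * δ)
      (fun i => a i S δ hδ (fun x hx => hS x (Set.mem_iUnion.mpr ⟨i, hx⟩)))
    convert this using 2
    simp [Module.End.mul_apply]

theorem char_orth {B : Type} [AddCommGroup B] [Fintype B] [DecidableEq B] (a b : B) :
    ∑ χ : AddChar B ℂ, ((χ a).re * (χ b).re + (χ a).im * (χ b).im) =
      if a = b then (Fintype.card B : ℝ) else 0 := by
  have h := AddChar.sum_apply_eq_ite (a - b)
  have h2 := congrArg Complex.re h
  rw [Complex.re_sum] at h2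
  have : ∀ χ : AddChar B ℂ, (χ a).re * (χ b).re + (χ a).im * (χ b).im = (χ (a - b)).re := by
    intro χ
    rw [sub_eq_add_neg, AddChar.map_add_eq_mul, AddChar.map_neg_eq_conj]
    simp
  simp only [this, h2, sub_eq_zero]
  split_ifs <;> simp

theorem piece {B : Type} [AddCommGroup B] [Finite B] (ρ : B → Γ)
    (hρ : ∀ a b, ρ (a + b) = ρ a * ρ b) (hinj : Function.Injective ρ)
    (hres : ∀ γ : Γ, γ ≠ 1 → ∀ᶠ N in Filter.atTop, π N γ ≠ 1)
    {ι : Type*} [Fintype ι] (pt : ι → B) (c : ι → ℝ) (κ : ℝ) (hκ0 : 0 ≤ κ)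
    (hκ : RepBound 𝕜 pt c κ) :
    SmallM π κ 2 (∑ i, (c i : 𝕜) • Rop 𝕜 (ρ (pt i))) := by
  classical
  have := Fintype.ofFinite B
  intro g g'
  let x : (ℂ → ℝ) → AddChar B ℂ → XX 𝕜 G := fun part χ =>
    ∑ i, ((c i : 𝕜) * (part (χ (pt i)) : 𝕜)) • UU π (g * ρ (pt i) * g')
  have h0 : ρ 0 = 1 := by
    have := hρ 0 0
    simpa using this
  have unit : ∀ (χ : AddChar B ℂ) a, (χ a).re ^ 2 + (χ a).im ^ 2 = 1 := by
    intro χ a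
    have : ‖χ a‖ ^ 2 = 1 := by rw [AddChar.norm_apply]; norm_num
    rw [← Complex.normSq_eq_norm_sq, Complex.normSq_apply] at this
    nlinarith
  have hx : ∀ part, (part = Complex.re ∨ part = Complex.im) → ∀ χ, ‖x part χ‖ ≤ κ := by
    intro part hpart χ
    refine lp.norm_le_of_forall_le hκ0 (fun N => bil_norm_le _ _ hκ0 (fun a b => ?_))
    have := rep_bound (fun b => π N (ρ b)) (fun a b => by rw [hρ, map_mul]) (π N g) (π N g') pt c κ hκ
      (fun b => (χ b).re) (fun b => (χ b).im)
      (fun a b => by simp [AddChar.map_add_eq_mul])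
      (fun a b => by simp [AddChar.map_add_eq_mul]; ring)
      (fun a => unit χ a) (fun b => part (χ b))
      (by rcases hpart with rfl | rfl; exacts [Or.inl rfl, Or.inr rfl]) a b
    refine le_trans (le_of_eq ?_) this
    congr 1
    have e : (x part χ) N = ∑ i, ((c i : 𝕜) * (part (χ (pt i)) : 𝕜)) • ub (π N (g * ρ (pt i) * g')) := by
      simp only [x]
      rw [lp.coeFn_sum, Finset.sum_apply]
      rfl
    rw [e]
    simp [sum_apply, mul_assoc]
  refine ⟨Set.range (x Complex.re) ∪ Set.range (x Complex.im),
    (Set.finite_range _).union (Set.finite_range _), ?_, ?_⟩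
  · rintro _ (⟨χ, rfl⟩ | ⟨χ, rfl⟩)
    exacts [hx _ (Or.inl rfl) χ, hx _ (Or.inr rfl) χ]
  have hev : ∀ᶠ N in Filter.atTop, ∀ b : B, b ≠ 0 → π N (ρ b) ≠ 1 := by
    rw [Filter.eventually_all]
    intro b
    by_cases hb : b = 0
    · simp [hb]
    · have : ρ b ≠ 1 := fun h => hb (hinj (by rw [h, h0]))
      filter_upwards [hres _ this] with N hN _ using hN
  filter_upwards [hev] with N hN S δ hδ hS
  have hinjN : Function.Injective (fun b => π N (ρ b)) := by
    intro a b hab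
    by_contra hne
    apply hN (a - b) (sub_ne_zero.mpr hne)
    have e1 : ρ a = ρ (a - b) * ρ b := by rw [← hρ]; simp
    have e2 : π N (ρ a) = π N (ρ (a - b)) * π N (ρ b) := by rw [← map_mul, ← e1]
    simp only at hab
    rw [hab] at e2
    exact (right_eq_mul.mp e2)
  have hρN : ∀ a b, π N (ρ (a + b)) = π N (ρ a) * π N (ρ b) := fun a b => by rw [hρ, map_mul]
  have hB : (0:ℝ) < Fintype.card B := by exact_mod_cast Fintype.card_pos
  have hB' : (Fintype.card B : 𝕜) ≠ 0 := by exact_mod_cast hB.ne'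
  set Y : (B → ℝ) → Bil 𝕜 (G N) → 𝕜 := fun φ y =>
    ∑ k, (φ k : 𝕜) * tau (π N g * π N (ρ k) * π N g') y with hY
  have sumone : ∀ χ : AddChar B ℂ, ∑ k, (χ k).re ^ 2 + ∑ k, (χ k).im ^ 2 = Fintype.card B := by
    intro χ
    rw [← Finset.sum_add_distrib]
    simp [unit]
  have Yre : ∀ (χ : AddChar B ℂ) y, ‖Y (fun k => (χ k).re) y‖ ≤ ‖y‖ := by
    intro χ y
    refine func_bound (fun b => π N (ρ b)) hρN hinjN _ _ _
      (fun k => (χ k).re) (fun k => (χ k).re) (fun k => (χ k).im) (fun k => (χ k).im) ?_ ?_ y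
    · intro k k'
      simp [sub_eq_add_neg, AddChar.map_add_eq_mul, AddChar.map_neg_eq_conj]
    · rw [Real.mul_self_sqrt (by positivity), Real.mul_self_sqrt (by positivity), sumone]
  have Yim : ∀ (χ : AddChar B ℂ) y, ‖Y (fun k => (χ k).im) y‖ ≤ ‖y‖ := by
    intro χ y
    refine func_bound (fun b => π N (ρ b)) hρN hinjN _ _ _
      (fun k => (χ k).im) (fun k => (χ k).re) (fun k => -(χ k).re) (fun k => (χ k).im) ?_ ?_ y
    · intro k k'
      simp [sub_eq_add_neg, AddChar.map_add_eq_mul, AddChar.map_neg_eq_conj]; ring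
    · have := sumone χ
      simp only [neg_sq]
      have h1 : 0 ≤ ∑ k, (χ k).re ^ 2 := by positivity
      have h2 : 0 ≤ ∑ k, (χ k).im ^ 2 := by positivity
      nlinarith [sq_nonneg (√(∑ k, (χ k).re ^ 2) - √(∑ k, (χ k).im ^ 2)), Real.sq_sqrt h1,
        Real.sq_sqrt h2]
  have main : (∑ i, (c i : 𝕜) • Rop 𝕜 (ρ (pt i))) (Rop 𝕜 g' (ff π N S)) g =
      (Fintype.card B : 𝕜)⁻¹ * ∑ χ : AddChar B ℂ, (Y (fun k => (χ k).re) ((S (x Complex.re χ)) N) +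
        Y (fun k => (χ k).im) ((S (x Complex.im χ)) N)) := by
    have e1 : ∀ (part : ℂ → ℝ) χ, (S (x part χ)) N =
        ∑ i, ((c i : 𝕜) * (part (χ (pt i)) : 𝕜)) • (S (UU π (g * ρ (pt i) * g'))) N := by
      intro part χ
      simp only [x, map_sum, map_smul]
      rw [lp.coeFn_sum, Finset.sum_apply]
      rfl
    have e2 : ∀ (part : ℂ → ℝ) χ, Y (fun k => part (χ k)) ((S (x part χ)) N) =
        ∑ i, ∑ k, (c i : 𝕜) * (((part (χ k) * part (χ (pt i)) : ℝ) : 𝕜) *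
          tau (π N g * π N (ρ k) * π N g') ((S (UU π (g * ρ (pt i) * g'))) N)) := by
      intro part χ
      rw [e1, hY]
      simp only
      rw [Finset.sum_comm]
      refine Finset.sum_congr rfl (fun k _ => ?_)
      have : ∀ γ (y : ι → Bil 𝕜 (G N)) (d : ι → 𝕜), tau γ (∑ i, d i • y i) = ∑ i, d i * tau γ (y i) := by
        intro γ y d
        have := map_sum (tauL (𝕜 := 𝕜) γ) (fun i => d i • y i) Finset.univ
        refine this.trans ?_
        refine Finset.sum_congr rfl (fun i _ => tau_smul _ _ _)
      rw [this, Finset.mul_sum]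
      refine Finset.sum_congr rfl (fun i _ => ?_)
      push_cast
      ring
    simp only [e2]
    simp only [← Finset.sum_add_distrib, ← mul_add, ← add_mul, ← RCLike.ofReal_add]
    rw [Finset.sum_comm, Finset.mul_sum]
    rw [LinearMap.sum_apply, Finset.sum_apply]
    refine Finset.sum_congr rfl (fun i _ => ?_)
    rw [Finset.sum_comm]
    simp only [← Finset.mul_sum, ← Finset.sum_mul, ← RCLike.ofReal_sum]
    simp only [char_orth]
    rw [Finset.sum_eq_single (pt i)]
    · simp only [if_true, LinearMap.smul_apply, Pi.smul_apply, Rop_apply, smul_eq_mul, ff, map_mul]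
      push_cast
      field_simp
    · intro b _ hb
      simp [hb]
    · simp
  have hN' : ∀ z : XX 𝕜 G, ‖z N‖ ≤ ‖z‖ := fun z => lp.norm_apply_le_norm (by simp) z N
  rw [main]
  have hcard : (Fintype.card B : 𝕜) = (Fintype.card (AddChar B ℂ) : 𝕜) := by
    rw [AddChar.card_eq]
  rw [hcard]
  refine norm_avg_le (fun χ : AddChar B ℂ => Y (fun k => (χ k).re) ((S (x Complex.re χ)) N) +
        Y (fun k => (χ k).im) ((S (x Complex.im χ)) N)) _ (fun χ => ?_)
  have b1 := (Yre χ _).trans ((hN' _).trans (hS (x Complex.re χ) (Or.inl ⟨χ, rfl⟩)))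
  have b2 := (Yim χ _).trans ((hN' _).trans (hS (x Complex.im χ) (Or.inr ⟨χ, rfl⟩)))
  refine (norm_add_le _ _).trans ?_
  linarith

end A4

section A5
open Polynomial
variable {𝕜 : Type*} [RCLike 𝕜]
variable {Γ : Type} [Group Γ] {G : ℕ → Type} [∀ N, Fintype (G N)] [∀ N, Group (G N)]

abbrev RR := (ZMod 3)[X]
abbrev DL (d : ℕ) := ↥(degreeLT (ZMod 3) d)

instance DL.fin (d : ℕ) : Finite (DL d) :=
  Finite.of_equiv _ (degreeLTEquiv (ZMod 3) d).toEquiv.symm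
instance DL.fintype (d : ℕ) : Fintype (DL d) := Fintype.ofFinite _

theorem DL.card (d : ℕ) : Fintype.card (DL d) = 3 ^ d := by
  rw [Fintype.card_congr (degreeLTEquiv (ZMod 3) d).toEquiv]
  simp [ZMod.card]

theorem mem_DL {d : ℕ} {a : RR} (hd : 0 < d) : a ∈ degreeLT (ZMod 3) d ↔ a.natDegree < d := by
  rw [mem_degreeLT]
  by_cases h : a = 0
  · simp [h, hd]
  · rw [natDegree_lt_iff_degree_lt h]

theorem DL_mono {d d' : ℕ} (h : d ≤ d') : degreeLT (ZMod 3) d ≤ degreeLT (ZMod 3) d' :=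
  degreeLT_mono h

theorem DL_mul {d : ℕ} {a : RR} (l : ℕ) (h : a ∈ degreeLT (ZMod 3) d) :
    X ^ l * a ∈ degreeLT (ZMod 3) (l + d) := by
  rw [mem_degreeLT] at *
  rw [degree_mul, degree_X_pow]
  push_cast
  by_cases ha : a = 0
  · simp only [ha, degree_zero, WithBot.add_bot]
    exact_mod_cast WithBot.bot_lt_coe (l + d)
  · rw [degree_eq_natDegree ha] at *
    norm_cast at *
    omega

/-- triple of consecutive root subgroups -/
structure Tri (x y z : RR → Γ) : Prop where
  ax : ∀ a b, x (a + b) = x a * x b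
  ay : ∀ a b, y (a + b) = y a * y b
  az : ∀ a b, z (a + b) = z a * z b
  cxy : ∀ a b, x a * y b = y b * x a
  cyz : ∀ a b, y a * z b = z b * y a
  brk : ∃ ε : RR, (ε = 1 ∨ ε = -1) ∧ ∀ a b, x a * z b = z b * x a * y (ε * a * b)
  inj : ∀ a b c, x a * y b * z c = 1 → a = 0 ∧ b = 0 ∧ c = 0

/-- averages over root subgroups -/
def EE (𝕜 : Type*) [RCLike 𝕜] (y : RR → Γ) (d : ℕ) : Module.End 𝕜 (Γ → 𝕜) :=
  (Fintype.card (DL d) : 𝕜)⁻¹ • ∑ a : DL d, Rop 𝕜 (y a)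

theorem EE_isAvg (y : RR → Γ) (d : ℕ) : IsAvg (EE 𝕜 y d) :=
  ⟨DL d, inferInstance, inferInstance, fun a => y a, rfl⟩

theorem EE_mul (y : RR → Γ) (hy : ∀ a b, y (a + b) = y a * y b) (d : ℕ) (t : RR)
    (ht : t ∈ degreeLT (ZMod 3) d) : EE 𝕜 y d * Rop 𝕜 (y t) = EE 𝕜 y d := by
  rw [EE, smul_mul_assoc, Finset.sum_mul]
  congr 1
  refine Fintype.sum_equiv (Equiv.addRight ⟨t, ht⟩) _ _ (fun a => ?_)
  simp [hy]

theorem mul_EE (y : RR → Γ) (hy : ∀ a b, y (a + b) = y a * y b) (d : ℕ) (t : RR)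
    (ht : t ∈ degreeLT (ZMod 3) d) : Rop 𝕜 (y t) * EE 𝕜 y d = EE 𝕜 y d := by
  rw [EE, mul_smul_comm, Finset.mul_sum]
  congr 1
  refine Fintype.sum_equiv (Equiv.addLeft ⟨t, ht⟩) _ _ (fun a => ?_)
  simp [hy]

variable {π : ∀ N, Γ →* G N}

theorem three_zero : (3 : RR) = 0 := by
  have : ((3 : ZMod 3)) = 0 := by decide
  rw [← map_ofNat C 3, this, map_zero]

theorem Tri.zx {x y z : RR → Γ} (h : Tri x y z) {ε : RR}
    (hb : ∀ a b, x a * z b = z b * x a * y (ε * a * b)) (a b : RR) :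
    z b * x a = x a * y (-(ε * a * b)) * z b := by
  have y0 : y 0 = 1 := by simpa using h.ay 0 0
  have e1 : y (ε * a * b) * y (-(ε * a * b)) = 1 := by rw [← h.ay, add_neg_cancel, y0]
  rw [mul_assoc, h.cyz, ← mul_assoc, hb, mul_assoc, e1, mul_one]


def rhoB (x y z : RR → Γ) (ε : RR) (l m w D : ℕ) (b : DL w × DL D) : Γ :=
  x (X ^ l * (b.1 : RR)) * y ((b.2 : RR) + ε * X ^ (l + m) * (b.1 : RR) * (b.1 : RR)) *
    z (X ^ m * (b.1 : RR))

theorem rhoB_add {x y z : RR → Γ} (h : Tri x y z) {ε : RR}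
    (hb : ∀ a b, x a * z b = z b * x a * y (ε * a * b)) (l m w D : ℕ) (a b : DL w × DL D) :
    rhoB x y z ε l m w D (a + b) = rhoB x y z ε l m w D a * rhoB x y z ε l m w D b := by
  revert a b
  rintro ⟨⟨e, he⟩, ⟨s, hs⟩⟩ ⟨⟨e', he'⟩, ⟨s', hs'⟩⟩
  simp only [rhoB, Prod.fst_add, Prod.snd_add, Submodule.coe_add]
  calc x (X ^ l * (e + e')) * y (s + s' + ε * X ^ (l + m) * (e + e') * (e + e')) * z (X ^ m * (e + e'))
      = x (X ^ l * e) * x (X ^ l * e') * (y (s + ε * X ^ (l + m) * e * e) *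
        y (-(ε * (X ^ l * e') * (X ^ m * e))) * y (s' + ε * X ^ (l + m) * e' * e')) *
        (z (X ^ m * e) * z (X ^ m * e')) := by
          rw [← h.ax, ← h.az, ← h.ay, ← h.ay]
          congr 2
          · congr 1; ring
          · congr 1
            linear_combination (ε * X ^ (l + m) * e * e') * three_zero
          · congr 1; ring
    _ = x (X ^ l * e) * y (s + ε * X ^ (l + m) * e * e) * (x (X ^ l * e') *
        y (-(ε * (X ^ l * e') * (X ^ m * e))) * z (X ^ m * e)) *
        (y (s' + ε * X ^ (l + m) * e' * e') * z (X ^ m * e')) := by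
          have c1 := h.cxy (X ^ l * e') (s + ε * X ^ (l + m) * e * e)
          have c2 := h.cyz (s' + ε * X ^ (l + m) * e' * e') (X ^ m * e)
          generalize x (X ^ l * e) = x1 at *
          generalize x (X ^ l * e') = x2 at *
          generalize y (s + ε * X ^ (l + m) * e * e) = y1 at *
          generalize y (s' + ε * X ^ (l + m) * e' * e') = y2 at *
          generalize z (X ^ m * e) = z1 at *
          generalize z (X ^ m * e') = z2 at *
          generalize y (-(ε * (X ^ l * e') * (X ^ m * e))) = y3 at *
          calc x1 * x2 * (y1 * y3 * y2) * (z1 * z2) = x1 * (x2 * y1) * y3 * (y2 * z1) * z2 := by group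
            _ = _ := by rw [c1, c2]; group
    _ = _ := by
          rw [← h.zx hb]; group

theorem rhoB_inj {x y z : RR → Γ} (h : Tri x y z) {ε : RR}
    (hb : ∀ a b, x a * z b = z b * x a * y (ε * a * b)) (l m w D : ℕ) :
    Function.Injective (rhoB x y z ε l m w D) := by
  have hρ := rhoB_add h hb l m w D
  have hdef : ∀ b, rhoB x y z ε l m w D b = x (X ^ l * (b.1 : RR)) *
    y ((b.2 : RR) + ε * X ^ (l + m) * (b.1 : RR) * (b.1 : RR)) * z (X ^ m * (b.1 : RR)) := fun _ => rfl
  generalize rhoB x y z ε l m w D = ρ at *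
  have h00 : ρ 0 = 1 := by simpa using hρ 0 0
  have hker : ∀ b, ρ b = 1 → b = 0 := by
    rintro ⟨⟨e, he⟩, ⟨s, hs⟩⟩ hb1
    obtain ⟨h1, h2, h3⟩ := h.inj _ _ _ ((hdef _).symm.trans hb1)
    simp only at h1 h2 h3
    have he0 : e = 0 := by
      rcases mul_eq_zero.mp h1 with h | h
      · exact absurd h (pow_ne_zero _ X_ne_zero)
      · exact h
    subst he0
    simp only [mul_zero, add_zero] at h2
    subst h2
    rfl
  intro a b hab
  have : ρ (a - b) = 1 := by
    have e1 : ρ a = ρ (a - b) * ρ b := by rw [← hρ]; simp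
    rw [hab] at e1
    exact right_eq_mul.mp e1
  exact sub_eq_zero.mp (hker _ this)

theorem degB (ε : RR) (hε0 : ε.natDegree = 0) {l m w d : ℕ} (hw : 1 ≤ w) (hd : l + m + w = d + 1)
    (e f : RR) (he : e ∈ degreeLT (ZMod 3) w) (hf : f ∈ degreeLT (ZMod 3) w) :
      ε * X ^ (l + m) * e * f ∈ degreeLT (ZMod 3) (d + w) := by
  rw [mem_DL (by omega)] at *
  have h1 := natDegree_mul_le (p := ε * X ^ (l + m) * e) (q := f)
  have h2 := natDegree_mul_le (p := ε * X ^ (l + m)) (q := e)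
  have h3 := natDegree_mul_le (p := ε) (q := (X ^ (l + m) : RR))
  rw [natDegree_X_pow] at h3
  omega

def jB (w d D : ℕ) (hd : d ≤ D) : DL d →+ DL w × DL D :=
  AddMonoidHom.mk' (fun s => (0, ⟨s, DL_mono hd s.2⟩)) (by
    intro a b
    rw [Prod.mk_add_mk, add_zero]
    rfl)

def hB (ε : RR) (hε0 : ε.natDegree = 0) {l m w d : ℕ} (hw : 1 ≤ w) (hd : l + m + w = d + 1)
    (e : DL w) : DL w × DL (d + w) :=
  (e, ⟨-(ε * X ^ (l + m) * (e : RR) * (e : RR)), neg_mem (degB ε hε0 hw hd e e e.2 e.2)⟩)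

def yB (ε : RR) (hε0 : ε.natDegree = 0) {l m w d : ℕ} (hw : 1 ≤ w) (hd : l + m + w = d + 1)
    (f : DL w) : DL w →+ DL w × DL (d + w) :=
  AddMonoidHom.mk' (fun e => (0, ⟨ε * X ^ (l + m) * (e : RR) * (f : RR), degB ε hε0 hw hd e f e.2 f.2⟩)) (by
    intro a b
    rw [Prod.mk_add_mk, add_zero]
    congr 1
    apply Subtype.ext
    simp only [Submodule.coe_add]
    ring)

theorem hB_fst (ε : RR) (hε0 : ε.natDegree = 0) {l m w d : ℕ} (hw : 1 ≤ w) (hd : l + m + w = d + 1)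
    (e : DL w) : (hB ε hε0 hw hd e).1 = e := rfl
theorem hB_snd (ε : RR) (hε0 : ε.natDegree = 0) {l m w d : ℕ} (hw : 1 ≤ w) (hd : l + m + w = d + 1)
    (e : DL w) : ((hB ε hε0 hw hd e).2 : RR) = -(ε * X ^ (l + m) * (e : RR) * (e : RR)) := rfl
theorem yB_fst (ε : RR) (hε0 : ε.natDegree = 0) {l m w d : ℕ} (hw : 1 ≤ w) (hd : l + m + w = d + 1)
    (f e : DL w) : (yB ε hε0 hw hd f e).1 = 0 := by
  rw [yB, AddMonoidHom.mk'_apply]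
theorem yB_snd (ε : RR) (hε0 : ε.natDegree = 0) {l m w d : ℕ} (hw : 1 ≤ w) (hd : l + m + w = d + 1)
    (f e : DL w) : ((yB ε hε0 hw hd f e).2 : RR) = ε * X ^ (l + m) * (e : RR) * (f : RR) := by
  rw [yB, AddMonoidHom.mk'_apply]
theorem jB_fst (w d D : ℕ) (hd : d ≤ D) (s : DL d) : (jB w d D hd s).1 = 0 := by
  rw [jB, AddMonoidHom.mk'_apply]
theorem mkB_snd {w D : ℕ} (e : DL w) (v : RR) (h : v ∈ degreeLT (ZMod 3) D) :
    (((e, ⟨v, h⟩) : DL w × DL D).2 : RR) = v := rfl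
theorem jB_snd (w d D : ℕ) (hd : d ≤ D) (s : DL d) : ((jB w d D hd s).2 : RR) = (s : RR) := by
  have h1 : jB w d D hd s = (0, ⟨s, DL_mono hd s.2⟩) := by rw [jB, AddMonoidHom.mk'_apply]
  exact (congrArg (fun b : DL w × DL D => (b.2 : RR)) h1).trans (mkB_snd 0 (s : RR) _)

theorem repB (ε : RR) (hε0 : ε.natDegree = 0) (hε1 : ε * ε = 1) {l m w d : ℕ} (hw : 1 ≤ w)
    (hd : l + m + w = d + 1) :
    RepBound 𝕜 (fun i : DL w × (DL d ⊕ DL (d + 1)) => hB ε hε0 hw hd i.1 +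
      Sum.elim (jB w d (d + w) (by omega)) (jB w (d + 1) (d + w) (by omega)) i.2)
      (fun i => Sum.elim (fun _ => (Fintype.card (DL w) : ℝ)⁻¹ * (Fintype.card (DL d) : ℝ)⁻¹)
        (fun _ => -((Fintype.card (DL w) : ℝ)⁻¹ * (Fintype.card (DL (d + 1)) : ℝ)⁻¹)) i.2)
      (2 / √(Fintype.card (DL w) : ℝ)) := by
  refine heis (𝕜 := 𝕜) _ _ (hB ε hε0 hw hd) (hB ε hε0 hw hd) (yB ε hε0 hw hd) ?_ ?_ ?_
  · intro e f
    refine Prod.ext ?_ (Subtype.ext ?_)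
    · rw [Prod.fst_add, Prod.fst_add, hB_fst, hB_fst, hB_fst, yB_fst, add_zero]
    · rw [Prod.snd_add, Prod.snd_add, Submodule.coe_add, Submodule.coe_add, hB_snd, hB_snd, hB_snd,
        yB_snd, Submodule.coe_add]
      linear_combination (-(ε * X ^ (l + m) * (e : RR) * (f : RR))) * three_zero
  · intro s0
    refine ⟨⟨s0, DL_mono (Nat.le_succ d) s0.2⟩, Prod.ext ?_ (Subtype.ext ?_)⟩
    · rw [jB_fst, jB_fst]
    · rw [jB_snd, jB_snd]
  · rintro ⟨f, hf⟩ hf0 ⟨s, hs⟩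
    have hf0' : f ≠ 0 := fun h => hf0 (Subtype.ext h)
    have hfd := (mem_DL hw).mp hf
    obtain ⟨j, hj⟩ : ∃ j, j = f.natDegree := ⟨_, rfl⟩
    rw [← hj] at hfd
    have hlc : f.coeff j ≠ 0 := by
      rw [hj, coeff_natDegree]; exact leadingCoeff_ne_zero.mpr hf0'
    obtain ⟨q, hq⟩ : ∃ q, q = s.coeff d / f.coeff j := ⟨_, rfl⟩
    obtain ⟨e, hedef⟩ : ∃ e : RR, e = ε * (C q * X ^ (w - 1 - j)) := ⟨_, rfl⟩
    have he : e ∈ degreeLT (ZMod 3) w := by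
      rw [mem_DL hw]
      have h1 := natDegree_mul_le (p := ε) (q := (C q * X ^ (w - 1 - j) : RR))
      have h2 := natDegree_C_mul_X_pow_le q (w - 1 - j)
      rw [hedef]
      omega
    have hprod : ε * X ^ (l + m) * e * f = X ^ (d - j) * (C q * f) := by
      have : d - j = (l + m) + (w - 1 - j) := by omega
      rw [this, pow_add, hedef]
      linear_combination (X ^ (l + m) * (C q * X ^ (w - 1 - j)) * f) * hε1
    have hs0 : s - ε * X ^ (l + m) * e * f ∈ degreeLT (ZMod 3) d := by
      rw [hprod, mem_degreeLT, degree_lt_iff_coeff_zero]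
      intro n hn
      rw [coeff_sub, coeff_X_pow_mul', if_pos (by omega), coeff_C_mul]
      rcases Nat.lt_or_eq_of_le hn with hn | hn
      · have c1 : s.coeff n = 0 := by
          rw [mem_degreeLT, degree_lt_iff_coeff_zero] at hs
          exact hs n hn
        have c2 : f.coeff (n - (d - j)) = 0 := coeff_eq_zero_of_natDegree_lt (by omega)
        rw [c1, c2, mul_zero, sub_zero]
      · have : n - (d - j) = j := by omega
        rw [this, hq, div_mul_cancel₀ _ hlc, hn, sub_self]
    refine ⟨⟨e, he⟩, ⟨_, hs0⟩, ?_⟩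
    refine Prod.ext ?_ (Subtype.ext ?_)
    · rw [Prod.fst_add, yB_fst, jB_fst, jB_fst, add_zero]
    · rw [Prod.snd_add, Submodule.coe_add, yB_snd, jB_snd, jB_snd]
      ring

theorem k1B {x y z : RR → Γ} (ε : RR) (hε0 : ε.natDegree = 0) {l m w d : ℕ} (hw : 1 ≤ w)
    (hd : l + m + w = d + 1) (d' : ℕ) (hd' : d' ≤ d + w) (e : DL w) (s : DL d') :
    rhoB x y z ε l m w (d + w) (hB ε hε0 hw hd e + jB w d' (d + w) hd' s) =
      x (X ^ l * (e : RR)) * y s * z (X ^ m * (e : RR)) := by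
  have e1 : (hB ε hε0 hw hd e + jB w d' (d + w) hd' s) = (e, ⟨-(ε * X ^ (l + m) * (e : RR) * (e : RR)) + (s : RR),
    add_mem (neg_mem (degB ε hε0 hw hd e e e.2 e.2)) (DL_mono hd' s.2)⟩) := by
    refine Prod.ext ?_ (Subtype.ext ?_)
    · rw [Prod.fst_add, hB_fst, jB_fst, add_zero]
    · rw [Prod.snd_add, Submodule.coe_add, hB_snd, jB_snd]
  rw [e1, rhoB]
  congr 3
  simp only
  ring

theorem basic_move {x y z : RR → Γ} (h : Tri x y z)
    (hres : ∀ γ : Γ, γ ≠ 1 → ∀ᶠ N in Filter.atTop, π N γ ≠ 1)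
    (l m w p r d : ℕ) (hw : 1 ≤ w) (hp : l + w ≤ p) (hr : m + w ≤ r) (hd : l + m + w = d + 1) :
    SmallM π (2 / √(3 ^ w : ℝ)) 2 (EE 𝕜 x p * (EE 𝕜 y d - EE 𝕜 y (d + 1)) * EE 𝕜 z r) := by
  obtain ⟨ε, hε, hb⟩ := h.brk
  have hε0 : ε.natDegree = 0 := by rcases hε with rfl | rfl <;> simp
  have hε1 : ε * ε = 1 := by rcases hε with rfl | rfl <;> simp
  have hP := piece (𝕜 := 𝕜) (π := π) _ (rhoB_add h hb l m w (d + w)) (rhoB_inj h hb l m w (d + w)) hres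
    _ _ _ (by positivity) (repB ε hε0 hε1 hw hd)
  have key : EE 𝕜 x p * (EE 𝕜 y d - EE 𝕜 y (d + 1)) * EE 𝕜 z r = EE 𝕜 x p *
      (∑ i : DL w × (DL d ⊕ DL (d + 1)),
        ((Sum.elim (fun _ => (Fintype.card (DL w) : ℝ)⁻¹ * (Fintype.card (DL d) : ℝ)⁻¹)
        (fun _ => -((Fintype.card (DL w) : ℝ)⁻¹ * (Fintype.card (DL (d + 1)) : ℝ)⁻¹)) i.2 : ℝ) : 𝕜) •
         Rop 𝕜 (rhoB x y z ε l m w (d + w) (hB ε hε0 hw hd i.1 +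
      Sum.elim (jB w d (d + w) (by omega)) (jB w (d + 1) (d + w) (by omega)) i.2))) * EE 𝕜 z r := by
    have hW : (Fintype.card (DL w) : 𝕜) ≠ 0 := by exact_mod_cast Fintype.card_ne_zero
    have k2 : (∑ i : DL w × (DL d ⊕ DL (d + 1)),
        ((Sum.elim (fun _ => (Fintype.card (DL w) : ℝ)⁻¹ * (Fintype.card (DL d) : ℝ)⁻¹)
        (fun _ => -((Fintype.card (DL w) : ℝ)⁻¹ * (Fintype.card (DL (d + 1)) : ℝ)⁻¹)) i.2 : ℝ) : 𝕜) •
         Rop 𝕜 (rhoB x y z ε l m w (d + w) (hB ε hε0 hw hd i.1 +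
      Sum.elim (jB w d (d + w) (by omega)) (jB w (d + 1) (d + w) (by omega)) i.2))) = (Fintype.card (DL w) : 𝕜)⁻¹ • ∑ e : DL w,
          Rop 𝕜 (x (X ^ l * (e : RR))) * (EE 𝕜 y d - EE 𝕜 y (d + 1)) * Rop 𝕜 (z (X ^ m * (e : RR))) := by
      rw [Fintype.sum_prod_type, Finset.smul_sum]
      refine Finset.sum_congr rfl (fun e _ => ?_)
      rw [Fintype.sum_sum_type]
      simp only [Sum.elim_inl, Sum.elim_inr]
      simp only [k1B, map_mul]
      rw [← Finset.smul_sum, ← Finset.smul_sum, ← Finset.sum_mul, ← Finset.sum_mul,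
        ← Finset.mul_sum, ← Finset.mul_sum, EE, EE]
      push_cast
      rw [mul_sub, sub_mul]
      simp only [mul_smul_comm, smul_mul_assoc]
      module
    rw [k2, mul_smul_comm, smul_mul_assoc, Finset.mul_sum, Finset.sum_mul]
    have k3 : ∀ e : DL w, EE 𝕜 x p * (Rop 𝕜 (x (X ^ l * (e : RR))) * (EE 𝕜 y d - EE 𝕜 y (d + 1)) *
        Rop 𝕜 (z (X ^ m * (e : RR)))) * EE 𝕜 z r = EE 𝕜 x p * (EE 𝕜 y d - EE 𝕜 y (d + 1)) * EE 𝕜 z r := by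
      intro e
      have a1 := EE_mul (𝕜 := 𝕜) x h.ax p (X ^ l * (e : RR)) (DL_mono hp (DL_mul l e.2))
      have a2 := mul_EE (𝕜 := 𝕜) z h.az r (X ^ m * (e : RR)) (DL_mono hr (DL_mul m e.2))
      calc _ = (EE 𝕜 x p * Rop 𝕜 (x (X ^ l * (e : RR)))) * (EE 𝕜 y d - EE 𝕜 y (d + 1)) *
            (Rop 𝕜 (z (X ^ m * (e : RR))) * EE 𝕜 z r) := by simp only [mul_assoc]
        _ = _ := by rw [a1, a2]
    simp only [k3, Finset.sum_const, Finset.card_univ]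
    rw [← Nat.cast_smul_eq_nsmul 𝕜, smul_smul, inv_mul_cancel₀ hW, one_smul]
  rw [key]
  have hcard : (3 ^ w : ℝ) = (Fintype.card (DL w) : ℝ) := by rw [DL.card]; norm_num
  rw [hcard]
  exact (hP.avg_mul (EE_isAvg x p)).mul_avg (EE_isAvg z r)

end A5

section A6
open Polynomial
variable {𝕜 : Type*} [RCLike 𝕜]
variable {Γ : Type} [Group Γ] {G : ℕ → Type} [∀ N, Fintype (G N)] [∀ N, Group (G N)]

theorem Tri.rev {x y z : RR → Γ} (h : Tri x y z) : Tri z y x := by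
  have x0 : x 0 = 1 := by simpa using h.ax 0 0
  have y0 : y 0 = 1 := by simpa using h.ay 0 0
  have z0 : z 0 = 1 := by simpa using h.az 0 0
  have xn : ∀ a, (x a)⁻¹ = x (-a) := fun a => inv_eq_of_mul_eq_one_left (by rw [← h.ax]; simp [x0])
  have yn : ∀ a, (y a)⁻¹ = y (-a) := fun a => inv_eq_of_mul_eq_one_left (by rw [← h.ay]; simp [y0])
  have zn : ∀ a, (z a)⁻¹ = z (-a) := fun a => inv_eq_of_mul_eq_one_left (by rw [← h.az]; simp [z0])
  refine ⟨h.az, h.ay, h.ax, fun a b => (h.cyz b a).symm, fun a b => (h.cxy b a).symm, ?_, ?_⟩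
  · obtain ⟨ε, hε, hb⟩ := h.brk
    refine ⟨-ε, ?_, fun a b => ?_⟩
    · rcases hε with rfl | rfl
      · exact Or.inr rfl
      · left; simp
    · rw [hb b a, mul_assoc, mul_assoc, ← h.ay]
      have : ε * b * a + -ε * a * b = 0 := by ring
      rw [this, y0, mul_one]
  · intro a b c habc
    have h2 : x (-c) * y (-b) * z (-a) = 1 := by
      rw [← xn, ← yn, ← zn, ← mul_inv_rev, ← mul_inv_rev, ← mul_assoc, habc, inv_one]
    obtain ⟨h3, h4, h5⟩ := h.inj _ _ _ h2
    exact ⟨neg_eq_zero.mp h5, neg_eq_zero.mp h4, neg_eq_zero.mp h3⟩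

theorem EE_comm {x y : RR → Γ} (hc : ∀ a b, x a * y b = y b * x a) (q : ℕ) (a : RR) :
    Rop 𝕜 (x a) * EE 𝕜 y q = EE 𝕜 y q * Rop 𝕜 (x a) := by
  rw [EE, mul_smul_comm, smul_mul_assoc, Finset.mul_sum, Finset.sum_mul]
  congr 1
  refine Finset.sum_congr rfl (fun b _ => ?_)
  rw [← map_mul, ← map_mul, hc]

theorem reorder {x y z : RR → Γ} (h : Tri x y z) (p q n : ℕ) (hq : p + n ≤ q + 1) :
    EE 𝕜 x p * EE 𝕜 y q * EE 𝕜 z n = EE 𝕜 z n * EE 𝕜 y q * EE 𝕜 x p := by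
  obtain ⟨ε, hε, hb⟩ := h.brk
  have hε0 : ε.natDegree = 0 := by rcases hε with rfl | rfl <;> simp
  have key : ∀ (a : DL p) (c : DL n), Rop 𝕜 (x a) * EE 𝕜 y q * Rop 𝕜 (z c) =
      Rop 𝕜 (z c) * EE 𝕜 y q * Rop 𝕜 (x a) := by
    intro a c
    have hmem : ε * (a : RR) * (c : RR) ∈ degreeLT (ZMod 3) q := by
      rcases Nat.eq_zero_or_pos p with rfl | hp
      · have := a.2
        rw [mem_degreeLT] at this
        have : (a : RR) = 0 := by
          by_contra hne
          rw [degree_eq_natDegree hne] at this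
          exact absurd this (by norm_cast)
        rw [this]; simp
      rcases Nat.eq_zero_or_pos n with rfl | hn
      · have := c.2
        rw [mem_degreeLT] at this
        have : (c : RR) = 0 := by
          by_contra hne
          rw [degree_eq_natDegree hne] at this
          exact absurd this (by norm_cast)
        rw [this]; simp
      have ha := (mem_DL hp).mp a.2
      have hc := (mem_DL hn).mp c.2
      rw [mem_DL (by omega)]
      have h1 := natDegree_mul_le (p := ε * (a : RR)) (q := (c : RR))
      have h2 := natDegree_mul_le (p := ε) (q := (a : RR))
      omega
    have e1 : Rop 𝕜 (x a) * Rop 𝕜 (z c) = Rop 𝕜 (z c) * Rop 𝕜 (y (ε * a * c)) * Rop 𝕜 (x a) := by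
      rw [← map_mul, ← map_mul, ← map_mul, hb, mul_assoc (z c), h.cxy, mul_assoc (z c)]
    calc _ = EE 𝕜 y q * (Rop 𝕜 (x a) * Rop 𝕜 (z c)) := by rw [EE_comm h.cxy, mul_assoc]
      _ = (EE 𝕜 y q * Rop 𝕜 (z c)) * Rop 𝕜 (y (ε * a * c)) * Rop 𝕜 (x a) := by
        rw [e1]; simp only [mul_assoc]
      _ = _ := by
        rw [← EE_comm (fun a b => (h.cyz b a).symm), mul_assoc (Rop 𝕜 (z c)), EE_mul y h.ay q _ hmem]
  have hx : EE 𝕜 x p = (Fintype.card (DL p) : 𝕜)⁻¹ • ∑ a : DL p, Rop 𝕜 (x a) := rfl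
  have hz : EE 𝕜 z n = (Fintype.card (DL n) : 𝕜)⁻¹ • ∑ a : DL n, Rop 𝕜 (z a) := rfl
  rw [hx, hz]
  simp only [smul_mul_assoc, mul_smul_comm, Finset.sum_mul, Finset.mul_sum, key]
  rw [← Finset.smul_sum, ← Finset.smul_sum, smul_comm, Finset.sum_comm]

variable {π : ∀ N, Γ →* G N}

theorem move {x y z : RR → Γ} (h : Tri x y z)
    (hres : ∀ γ : Γ, γ ≠ 1 → ∀ᶠ N in Filter.atTop, π N γ ≠ 1)
    (w p r d k : ℕ) (hw : 1 ≤ w) (hp : w ≤ p) (hr : w ≤ r) (hd : w ≤ d + 1) (hk : d + k + w ≤ p + r) :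
    SmallM π (2 / √(3 ^ w : ℝ)) (2 * k) (EE 𝕜 x p * (EE 𝕜 y d - EE 𝕜 y (d + k)) * EE 𝕜 z r) := by
  induction k with
  | zero => 
    simp only [add_zero, sub_self, mul_zero, zero_mul, Nat.cast_zero]
    exact SmallM.zero
  | succ k ih =>
    have h1 := ih (by omega)
    have h2 := basic_move (𝕜 := 𝕜) h hres (min (p - w) (d + k + 1 - w)) (d + k + 1 - w - min (p - w) (d + k + 1 - w))
      w p r (d + k) hw (by omega) (by omega) (by omega)
    have h3 := h1.add h2
    convert h3 using 1
    · push_cast; ring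
    · rw [← add_mul, ← mul_add, sub_add_sub_cancel, add_assoc]

theorem SmallM.tr {r M M' : ℝ} {a b c : Module.End 𝕜 (Γ → 𝕜)} (h1 : SmallM π r M (a - b))
    (h2 : SmallM π r M' (b - c)) : SmallM π r (M + M') (a - c) := by
  have := h1.add h2
  rwa [sub_add_sub_cancel] at this

theorem SmallM.sy {r M : ℝ} {a b : Module.End 𝕜 (Γ → 𝕜)} (h1 : SmallM π r M (a - b)) :
    SmallM π r M (b - a) := by
  have := h1.neg
  rwa [neg_sub] at this

def Wd (𝕜 : Type*) [RCLike 𝕜] (x1 x2 x3 x4 x5 x6 : RR → Γ) (a b c d e f : ℕ) : Module.End 𝕜 (Γ → 𝕜) :=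
  EE 𝕜 x1 a * EE 𝕜 x2 b * EE 𝕜 x3 c * EE 𝕜 x4 d * EE 𝕜 x5 e * EE 𝕜 x6 f

theorem up {x1 x2 x3 x4 x5 x6 : RR → Γ} (h1 : Tri x1 x2 x3) (h2 : Tri x2 x3 x4) (h3 : Tri x3 x4 x5)
    (h4 : Tri x4 x5 x6) (hres : ∀ γ : Γ, γ ≠ 1 → ∀ᶠ N in Filter.atTop, π N γ ≠ 1)
    (w p n q : ℕ) (hw : 1 ≤ w) (hp : w ≤ p) (hn : w ≤ n) (hwpn : 2 * w + 1 ≤ p + n) (hq : q = p + n) :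
    SmallM π (2 / √(3 ^ w : ℝ)) (8 * w + 8) (Wd 𝕜 x1 x2 x3 x4 x5 x6 p q n n q p -
      Wd 𝕜 x1 x2 x3 x4 x5 x6 p (q + 1) (n + 1) (n + 1) (q + 1) p) := by
  have A := fun (x : RR → Γ) d => EE_isAvg (𝕜 := 𝕜) x d
  have m3 : ∀ q' d k n', w ≤ q' → w ≤ n' → w ≤ d + 1 → d + k + w ≤ q' + n' → ∀ p' q'' p'',
      SmallM π (2 / √(3 ^ w : ℝ)) (2 * k) (Wd 𝕜 x1 x2 x3 x4 x5 x6 p' q' d n' q'' p'' -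
        Wd 𝕜 x1 x2 x3 x4 x5 x6 p' q' (d + k) n' q'' p'') := by
    intro q' d k n' a1 a2 a3 a4 p' q'' p''
    have := (((move (𝕜 := 𝕜) h2 hres w q' n' d k hw a1 a2 a3 a4).avg_mul (A x1 p')).mul_avg (A x5 q'')).mul_avg (A x6 p'')
    convert this using 1
    simp only [Wd, mul_sub, sub_mul, mul_assoc]
  have m2 : ∀ q' d k n', w ≤ q' → w ≤ n' → w ≤ d + 1 → d + k + w ≤ q' + n' → ∀ p' q'' p'',
      SmallM π (2 / √(3 ^ w : ℝ)) (2 * k) (Wd 𝕜 x1 x2 x3 x4 x5 x6 q' d n' p' q'' p'' -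
        Wd 𝕜 x1 x2 x3 x4 x5 x6 q' (d + k) n' p' q'' p'') := by
    intro q' d k n' a1 a2 a3 a4 p' q'' p''
    have := (((move (𝕜 := 𝕜) h1 hres w q' n' d k hw a1 a2 a3 a4).mul_avg (A x4 p')).mul_avg (A x5 q'')).mul_avg (A x6 p'')
    convert this using 1
    simp only [Wd, mul_sub, sub_mul, mul_assoc]
  have m4 : ∀ q' d k n', w ≤ q' → w ≤ n' → w ≤ d + 1 → d + k + w ≤ q' + n' → ∀ p' q'' p'',
      SmallM π (2 / √(3 ^ w : ℝ)) (2 * k) (Wd 𝕜 x1 x2 x3 x4 x5 x6 p' q'' q' d n' p'' -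
        Wd 𝕜 x1 x2 x3 x4 x5 x6 p' q'' q' (d + k) n' p'') := by
    intro q' d k n' a1 a2 a3 a4 p' q'' p''
    have := (((move (𝕜 := 𝕜) h3 hres w q' n' d k hw a1 a2 a3 a4).avg_mul (A x2 q'')).avg_mul (A x1 p')).mul_avg (A x6 p'')
    convert this using 1
    simp only [Wd, mul_sub, sub_mul, mul_assoc]
  have m5 : ∀ q' d k n', w ≤ q' → w ≤ n' → w ≤ d + 1 → d + k + w ≤ q' + n' → ∀ p' q'' p'',
      SmallM π (2 / √(3 ^ w : ℝ)) (2 * k) (Wd 𝕜 x1 x2 x3 x4 x5 x6 p' q'' p'' q' d n' -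
        Wd 𝕜 x1 x2 x3 x4 x5 x6 p' q'' p'' q' (d + k) n') := by
    intro q' d k n' a1 a2 a3 a4 p' q'' p''
    have := (((move (𝕜 := 𝕜) h4 hres w q' n' d k hw a1 a2 a3 a4).avg_mul (A x3 p'')).avg_mul (A x2 q'')).avg_mul (A x1 p')
    convert this using 1
    simp only [Wd, mul_sub, sub_mul, mul_assoc]
  have sa := m3 q n (1 + w) n (by omega) (by omega) (by omega) (by omega) p q p
  have sb := m2 p q 1 (n + (1 + w)) (by omega) (by omega) (by omega) (by omega) n q p
  have sc := (m3 (q + 1) (n + 1) w n (by omega) (by omega) (by omega) (by omega) p q p).sy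
  have sd := m4 (n + 1) n (1 + w) q (by omega) (by omega) (by omega) (by omega) p (q + 1) p
  have se := m5 (n + (1 + w)) q 1 p (by omega) (by omega) (by omega) (by omega) p (q + 1) (n + 1)
  have sf := (m4 (n + 1) (n + 1) w (q + 1) (by omega) (by omega) (by omega) (by omega) p (q + 1) p).sy
  rw [add_assoc n 1 w] at sc sf
  refine (((((sa.tr sb).tr sc).tr sd).tr se).tr sf).mono le_rfl (le_of_eq ?_)
  push_cast
  ring

structure Sys (x1 x2 x3 x4 x5 x6 : RR → Γ) : Prop where
  h1 : Tri x1 x2 x3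
  h2 : Tri x2 x3 x4
  h3 : Tri x3 x4 x5
  h4 : Tri x4 x5 x6
  h5 : Tri x5 x6 x1
  h6 : Tri x6 x1 x2

theorem Wd_reorder {x1 x2 x3 x4 x5 x6 : RR → Γ} (h1 : Tri x1 x2 x3) (h4 : Tri x4 x5 x6)
    (p q n : ℕ) (hq : p + n ≤ q + 1) :
    Wd 𝕜 x1 x2 x3 x4 x5 x6 p q n n q p = Wd 𝕜 x3 x2 x1 x6 x5 x4 n q p p q n := by
  have e1 := reorder (𝕜 := 𝕜) h1 p q n hq
  have e2 := reorder (𝕜 := 𝕜) h4 n q p (by omega)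
  rw [Wd, e1, mul_assoc, mul_assoc, ← mul_assoc (EE 𝕜 x4 n), e2, Wd]
  simp only [mul_assoc]

def muk (𝕜 : Type*) [RCLike 𝕜] (x1 x2 x3 x4 x5 x6 : RR → Γ) (k : ℕ) : Module.End 𝕜 (Γ → 𝕜) :=
  Wd 𝕜 x1 x2 x3 x4 x5 x6 k (2 * k) k k (2 * k) k

theorem muk_step {x1 x2 x3 x4 x5 x6 : RR → Γ} (h : Sys x1 x2 x3 x4 x5 x6)
    (hres : ∀ γ : Γ, γ ≠ 1 → ∀ᶠ N in Filter.atTop, π N γ ≠ 1) (w : ℕ) (hw : 1 ≤ w) :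
    SmallM π (2 / √(3 ^ w : ℝ)) (16 * w + 16) (muk 𝕜 x1 x2 x3 x4 x5 x6 (w + 1) -
      muk 𝕜 x1 x2 x3 x4 x5 x6 (w + 2)) := by
  have s1 := up (𝕜 := 𝕜) h.h1 h.h2 h.h3 h.h4 hres w (w + 1) (w + 1) (2 * (w + 1)) hw (by omega) (by omega)
    (by omega) (by omega)
  have s2 := up (𝕜 := 𝕜) h.h1.rev h.h6.rev h.h5.rev h.h4.rev hres w (w + 2) (w + 1) (2 * (w + 1) + 1) hw
    (by omega) (by omega) (by omega) (by omega)
  rw [Wd_reorder h.h1 h.h4 _ _ _ (by omega)] at s1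
  rw [← Wd_reorder h.h1 h.h4 _ _ _ (by omega)] at s1
  have e1 := Wd_reorder (𝕜 := 𝕜) h.h1 h.h4 (w + 1) (2 * (w + 1) + 1) (w + 2) (by omega)
  have e2 := Wd_reorder (𝕜 := 𝕜) h.h1 h.h4 (w + 2) (2 * (w + 2)) (w + 2) (by omega)
  rw [← e1] at s2
  have e3 : 2 * (w + 1) + 1 + 1 = 2 * (w + 2) := by ring
  rw [e3] at s2
  have e4 : w + 1 + 1 = w + 2 := rfl
  rw [e4] at s1 s2
  rw [← e2] at s2
  have := s1.tr s2
  refine this.mono le_rfl (le_of_eq ?_)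
  ring

end A6

section A7
open Polynomial
variable {𝕜 : Type*} [RCLike 𝕜]
variable {Γ : Type} [Group Γ] {G : ℕ → Type} [∀ N, Fintype (G N)] [∀ N, Group (G N)]
variable {π : ∀ N, Γ →* G N}

theorem norm_tau_le {G : Type} [Fintype G] [Group G] (γ : G) (y : Bil 𝕜 G) : ‖tau γ y‖ ≤ ‖y‖ := by
  refine norm_avg_le _ _ (fun h => ?_)
  have := bil_apply_le y (dl (γ * h)) (dl h)
  rwa [norm_dl, norm_dl, mul_one, mul_one] at this

theorem tau_zero {G : Type} [Fintype G] [Group G] (γ : G) : tau γ (0 : Bil 𝕜 G) = 0 :=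
  map_zero (tauL (𝕜 := 𝕜) γ)

theorem sum_tau_le {G : Type} [Fintype G] [Group G] {ι : Type} [Fintype ι] (q : ι → G)
    (hq : Function.Injective q) (y : Bil 𝕜 G) :
    ∑ a, ‖tau (q a) y‖ ≤ ‖y‖ * √(Fintype.card ι) := by
  choose c hc1 hc using fun a => RCLike.exists_norm_eq_mul_self (tau (q a) y)
  have e1 : ((∑ a, ‖tau (q a) y‖ : ℝ) : 𝕜) = (Fintype.card G : 𝕜)⁻¹ * ∑ h, y (∑ a, c a • dl (q a * h)) (dl h) := by
    have : ((∑ a, ‖tau (q a) y‖ : ℝ) : 𝕜) = ∑ a, c a * tau (q a) y := by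
      push_cast
      exact Finset.sum_congr rfl (fun a _ => hc a)
    rw [this]
    simp only [tau, map_sum, map_smul, sum_apply, smul_apply, smul_eq_mul]
    rw [Finset.sum_comm, Finset.mul_sum]
    refine Finset.sum_congr rfl (fun a _ => ?_)
    rw [← Finset.mul_sum]
    ring
  have h0 : 0 ≤ ∑ a, ‖tau (q a) y‖ := Finset.sum_nonneg (fun _ _ => norm_nonneg _)
  have e2 : ∑ a, ‖tau (q a) y‖ = ‖((∑ a, ‖tau (q a) y‖ : ℝ) : 𝕜)‖ := by
    rw [RCLike.norm_ofReal, abs_of_nonneg h0]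
  rw [e2, e1]
  refine norm_avg_le _ _ (fun h => ?_)
  have := bil_apply_le y (∑ a, c a • dl (q a * h)) (dl h)
  rw [norm_dl, mul_one, norm_sum_dl (fun a => q a * h) (fun a b hab => hq (mul_right_cancel hab))] at this
  simpa [hc1] using this

theorem ff_add (N : ℕ) (S T : XX 𝕜 G →ₗ[𝕜] XX 𝕜 G) : ff π N (S + T) = ff π N S + ff π N T := by
  funext γ
  exact tau_add _ _ _

theorem ff_id (N : ℕ) : ff π N (LinearMap.id : XX 𝕜 G →ₗ[𝕜] XX 𝕜 G) = fun _ => 1 := by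
  funext γ
  exact tau_ub _

theorem IsAvg.apply_one {ν : Module.End 𝕜 (Γ → 𝕜)} (h : IsAvg ν) (g : Γ) : ν (fun _ => 1) g = 1 := by
  obtain ⟨ι, _, _, q, rfl⟩ := h
  have hc : (Fintype.card ι : 𝕜) ≠ 0 := by exact_mod_cast Fintype.card_ne_zero
  simp [Rop_apply, hc]

theorem muk_avg (x1 x2 x3 x4 x5 x6 : RR → Γ) (k : ℕ) : IsAvg (muk 𝕜 x1 x2 x3 x4 x5 x6 k) :=
  (((((EE_isAvg _ _).mul (EE_isAvg _ _)).mul (EE_isAvg _ _)).mul (EE_isAvg _ _)).mul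
    (EE_isAvg _ _)).mul (EE_isAvg _ _)

theorem muk_fac (x1 x2 x3 x4 x5 x6 : RR → Γ) (k : ℕ) : ∃ ν, IsAvg ν ∧
    muk 𝕜 x1 x2 x3 x4 x5 x6 k = EE 𝕜 x1 k * ν :=
  ⟨_, ((((EE_isAvg x2 (2 * k)).mul (EE_isAvg x3 k)).mul (EE_isAvg x4 k)).mul
    (EE_isAvg x5 (2 * k))).mul (EE_isAvg x6 k), by simp only [muk, Wd, mul_assoc]⟩

theorem init_small {ν : Module.End 𝕜 (Γ → 𝕜)} (h : IsAvg ν) : ∃ F : Set (XX 𝕜 G), F.Finite ∧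
    ∀ N (S : XX 𝕜 G →ₗ[𝕜] XX 𝕜 G) (δ : ℝ), 0 ≤ δ → (∀ x ∈ F, ‖S x‖ ≤ δ) → ‖ν (ff π N S) 1‖ ≤ δ := by
  obtain ⟨ι, _, _, q, rfl⟩ := h
  refine ⟨Set.range (fun i => UU π (q i)), Set.finite_range _, fun N S δ hδ hS => ?_⟩
  have := norm_avg_le (fun i => ff π N S (q i)) δ (fun i => (norm_tau_le _ _).trans
    ((lp.norm_apply_le_norm (by simp) _ N).trans (hS _ ⟨i, rfl⟩)))
  convert this using 2
  simp [Rop_apply]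

theorem compact_seq {X : Type*} [NormedAddCommGroup X] (F : ℕ → Set X) (hF : ∀ j, (F j).Finite)
    (b : ℕ → ℝ) (hb : Filter.Tendsto b Filter.atTop (nhds 0)) (hFb : ∀ j, ∀ x ∈ F j, ‖x‖ ≤ b j) :
    ∃ K : Set X, IsCompact K ∧ ∀ j, F j ⊆ K := by
  let f : (Σ j, F j) → X := fun i => i.2.1
  have h1 : Filter.Tendsto (fun i : (Σ j, F j) => i.1) Filter.cofinite Filter.cofinite := by
    refine Filter.Tendsto.cofinite_of_finite_preimage_singleton (fun j => ?_)
    have := (hF j).to_subtype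
    refine (Set.finite_range (fun x : F j => (⟨j, x⟩ : Σ j, F j))).subset ?_
    rintro ⟨j', x⟩ hj
    obtain rfl : j' = j := hj
    exact ⟨x, rfl⟩
  have h2 : Filter.Tendsto f Filter.cofinite (nhds 0) := by
    refine squeeze_zero_norm (fun i => hFb i.1 _ i.2.2) ?_
    rw [Nat.cofinite_eq_atTop] at h1
    exact hb.comp h1
  exact ⟨_, h2.isCompact_insert_range_of_cofinite, fun j x hx => Or.inr ⟨⟨j, ⟨x, hx⟩⟩, rfl⟩⟩

theorem decomp {X : Type*} [NormedAddCommGroup X] [NormedSpace 𝕜 X] (T : X →L[𝕜] X)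
    (hT : FiniteDimensional 𝕜 (LinearMap.range (T : X →ₗ[𝕜] X))) :
    ∃ (m : ℕ) (ψ : Fin m → X →L[𝕜] 𝕜) (y : Fin m → X), ∀ x, T x = ∑ s, ψ s x • y s := by
  let R := LinearMap.range (T : X →ₗ[𝕜] X)
  let b := Module.finBasis 𝕜 R
  let T' : X →L[𝕜] R := T.codRestrict R (fun x => ⟨x, rfl⟩)
  refine ⟨_, fun s => (LinearMap.toContinuousLinearMap (b.coord s)).comp T', fun s => (b s : X), fun x => ?_⟩
  have := congrArg (R.subtype) (b.sum_repr (T' x))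
  rw [map_sum] at this
  exact this.symm

theorem norm_ofReal_smul {X : Type*} [NormedAddCommGroup X] [NormedSpace 𝕜 X] (t : ℝ) (ht : 0 ≤ t) (x : X) :
    ‖(t : 𝕜) • x‖ = t * ‖x‖ := by
  rw [norm_smul, RCLike.norm_ofReal, abs_of_nonneg ht]

theorem map_scal {X : Type*} [NormedAddCommGroup X] [NormedSpace 𝕜 X] (S : X →ₗ[𝕜] X) (t : ℝ) (ht : 0 ≤ t) (x : X) :
    ‖S ((t : 𝕜) • x)‖ = t * ‖S x‖ := by
  rw [map_smul, norm_smul, RCLike.norm_ofReal, abs_of_nonneg ht]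

def scal (𝕜 : Type*) [RCLike 𝕜] {X : Type*} [NormedAddCommGroup X] [NormedSpace 𝕜 X] (t : ℝ) (x : X) : X :=
  (t : 𝕜) • x

set_option maxHeartbeats 2000000 in
theorem finrank_small {x1 x2 x3 x4 x5 x6 : RR → Γ} (h : Sys x1 x2 x3 x4 x5 x6)
    (hres : ∀ γ : Γ, γ ≠ 1 → ∀ᶠ N in Filter.atTop, π N γ ≠ 1) (T : XX 𝕜 G →L[𝕜] XX 𝕜 G)
    (hT : FiniteDimensional 𝕜 (LinearMap.range (T : XX 𝕜 G →ₗ[𝕜] XX 𝕜 G))) :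
    ∃ C : ℝ, 0 ≤ C ∧ ∀ k, ∀ᶠ N in Filter.atTop,
      ‖muk 𝕜 x1 x2 x3 x4 x5 x6 k (ff π N (T : XX 𝕜 G →ₗ[𝕜] XX 𝕜 G)) 1‖ ≤ C / √(3 ^ k : ℝ) := by
  -- decompose
  obtain ⟨m, ψ, y, hψ⟩ := decomp T hT
  refine ⟨∑ s, ‖ψ s‖ * ‖y s‖, by positivity, fun k => ?_⟩
  have hev : ∀ᶠ N in Filter.atTop, ∀ b : DL k, b ≠ 0 → π N (x1 b) ≠ 1 := by
    rw [Filter.eventually_all]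
    intro b
    by_cases hb : b = 0
    · simp [hb]
    · have : x1 b ≠ 1 := fun h1 => hb (Subtype.ext (h.h1.inj b 0 0 (by
        have y0 : x2 0 = 1 := by simpa using h.h1.ay 0 0
        have z0 : x3 0 = 1 := by simpa using h.h1.az 0 0
        rw [h1, y0, z0, one_mul, one_mul])).1)
      filter_upwards [hres _ this] with N hN _ using hN
  filter_upwards [hev] with N hN
  have hinjN : Function.Injective (fun b : DL k => π N (x1 b)) := by
    intro a b hab
    by_contra hne
    apply hN (a - b) (sub_ne_zero.mpr hne)
    have e1 : x1 a = x1 ((a - b : DL k) : RR) * x1 b := by rw [← h.h1.ax]; simp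
    have e2 : π N (x1 a) = π N (x1 ((a - b : DL k) : RR)) * π N (x1 b) := by rw [← map_mul, ← e1]
    simp only at hab
    rw [hab] at e2
    exact (right_eq_mul.mp e2)
  set f := ff π N (T : XX 𝕜 G →ₗ[𝕜] XX 𝕜 G) with hf
  have hfb : ∀ γ, ‖f γ‖ ≤ ∑ s, ‖ψ s‖ * ‖tau (π N γ) ((y s) N)‖ := by
    intro γ
    have e1 : f γ = ∑ s, ψ s (UU π γ) * tau (π N γ) ((y s) N) := by
      have : (T (UU π γ)) N = ∑ s, ψ s (UU π γ) • (y s) N := by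
        rw [hψ, lp.coeFn_sum, Finset.sum_apply]
        rfl
      change tau (π N γ) ((T (UU π γ)) N) = _
      rw [this]
      refine (map_sum (tauL (𝕜 := 𝕜) (π N γ)) (fun s => ψ s (UU π γ) • (y s) N) Finset.univ).trans ?_
      exact Finset.sum_congr rfl (fun i _ => tau_smul _ _ _)
    rw [e1]
    refine (norm_sum_le _ _).trans (Finset.sum_le_sum (fun s _ => ?_))
    rw [norm_mul]
    gcongr
    exact ((ψ s).le_opNorm _).trans (mul_le_of_le_one_right (norm_nonneg _) (norm_UU_le π γ))
  obtain ⟨ν, ⟨ι, _, _, q, hν⟩, hmu⟩ := muk_fac (𝕜 := 𝕜) x1 x2 x3 x4 x5 x6 k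
  have hcard : (3 ^ k : ℝ) = (Fintype.card (DL k) : ℝ) := by rw [DL.card]; norm_num
  have h3 : (0:ℝ) < Fintype.card (DL k) := by rw [← hcard]; positivity
  have e2 : muk 𝕜 x1 x2 x3 x4 x5 x6 k f 1 = (Fintype.card ι : 𝕜)⁻¹ * ∑ i,
      ((Fintype.card (DL k) : 𝕜)⁻¹ * ∑ a : DL k, f (x1 a * q i)) := by
    rw [hmu, hν, EE]
    simp only [Module.End.mul_apply, LinearMap.smul_apply, LinearMap.sum_apply, Finset.sum_apply, Pi.smul_apply,
      Rop_apply, smul_eq_mul, one_mul, Finset.mul_sum]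
    rw [Finset.sum_comm]
    refine Finset.sum_congr rfl (fun i _ => Finset.sum_congr rfl (fun a _ => ?_))
    ring
  rw [e2]
  refine norm_avg_le _ _ (fun i => ?_)
  rw [norm_mul, norm_inv, RCLike.norm_natCast, hcard, inv_mul_le_iff₀ h3]
  calc ‖∑ a : DL k, f (x1 a * q i)‖ ≤ ∑ a : DL k, ∑ s, ‖ψ s‖ * ‖tau (π N (x1 a * q i)) ((y s) N)‖ :=
        (norm_sum_le _ _).trans (Finset.sum_le_sum (fun a _ => hfb _))
    _ = ∑ s, ‖ψ s‖ * ∑ a : DL k, ‖tau (π N (x1 a * q i)) ((y s) N)‖ := by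
        rw [Finset.sum_comm]
        simp only [Finset.mul_sum]
    _ ≤ ∑ s, ‖ψ s‖ * (‖y s‖ * √(Fintype.card (DL k))) := by
        gcongr with s
        refine (sum_tau_le (fun a : DL k => π N (x1 a * q i)) (fun a b hab => ?_) _).trans ?_
        · simp only [map_mul] at hab
          exact hinjN (mul_right_cancel hab)
        · gcongr
          exact lp.norm_apply_le_norm (by simp) _ N
    _ = (∑ s, ‖ψ s‖ * ‖y s‖) * √(Fintype.card (DL k)) := by
        rw [Finset.sum_mul]
        simp only [mul_assoc]
    _ = _ := by
        have := Real.mul_self_sqrt h3.le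
        have h4 : √(Fintype.card (DL k) : ℝ) ≠ 0 := (Real.sqrt_pos.mpr h3).ne'
        field_simp
        rw [sq, this]

theorem not_AP_XX {x1 x2 x3 x4 x5 x6 : RR → Γ} (h : Sys x1 x2 x3 x4 x5 x6)
    (hres : ∀ γ : Γ, γ ≠ 1 → ∀ᶠ N in Filter.atTop, π N γ ≠ 1) : ¬ HasAP 𝕜 (XX 𝕜 G) := by
  intro hAP
  set μ := muk 𝕜 x1 x2 x3 x4 x5 x6 with hμ
  obtain ⟨F0, hF0, hF0'⟩ := init_small (π := π) (G := G) (muk_avg (𝕜 := 𝕜) x1 x2 x3 x4 x5 x6 2)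
  choose F hF hFr hFE using fun j : ℕ => muk_step (𝕜 := 𝕜) h hres (j + 1) (by omega) 1 1
  let F' : ℕ → Set (XX 𝕜 G) := fun j => scal 𝕜 ((4/3 : ℝ) ^ j) '' F j
  obtain ⟨K, hK, hFK⟩ := compact_seq F' (fun j => (hF j).image _) (fun j => 2 * (4/5 : ℝ) ^ j)
    (by
      have := (tendsto_pow_atTop_nhds_zero_of_lt_one (r := (4/5 : ℝ)) (by norm_num) (by norm_num)).const_mul 2
      simpa using this)
    (by
      rintro j _ ⟨x, hx, rfl⟩
      have h1 := hFr j x hx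
      rw [scal, norm_ofReal_smul _ (by positivity)]
      have h2 : √(3 ^ (j + 1) : ℝ) ≥ (5/3 : ℝ) ^ j := by
        apply Real.le_sqrt_of_sq_le
        calc ((5/3 : ℝ) ^ j) ^ 2 = (25 / 9 : ℝ) ^ j := by rw [← pow_mul, mul_comm, pow_mul]; norm_num
          _ ≤ 3 ^ j := by gcongr; norm_num
          _ ≤ 3 ^ (j + 1) := by gcongr <;> norm_num
      calc (4/3 : ℝ) ^ j * ‖x‖ ≤ (4/3 : ℝ) ^ j * (2 / (5/3 : ℝ) ^ j) := by
            gcongr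
            exact h1.trans (by gcongr)
        _ = 2 * (4/5 : ℝ) ^ j := by
            have h5 : (4/3 : ℝ) ^ j / (5/3 : ℝ) ^ j = (4/5 : ℝ) ^ j := by
              rw [← div_pow]; norm_num
            rw [← h5, mul_div_assoc', mul_comm, mul_div_assoc])
  obtain ⟨T, hT, hTK⟩ := hAP (F0 ∪ K) (hF0.isCompact.union hK) (1 / 642) (by norm_num)
  obtain ⟨C, hC0, hC⟩ := finrank_small h hres T hT
  let S : XX 𝕜 G →ₗ[𝕜] XX 𝕜 G := (T : XX 𝕜 G →ₗ[𝕜] XX 𝕜 G) - LinearMap.id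
  have hS : ∀ x ∈ F0 ∪ K, ‖S x‖ ≤ 1 / 642 := fun x hx => (hTK x hx).le
  have hSF : ∀ j, ∀ x ∈ F j, ‖S x‖ ≤ (3/4 : ℝ) ^ j * (1 / 642) := by
    intro j x hx
    have h1 := hS _ (Or.inr (hFK j ⟨x, hx, rfl⟩))
    rw [scal, map_scal _ _ (by positivity)] at h1
    have h2 : (3/4 : ℝ) ^ j * (4/3 : ℝ) ^ j = 1 := by rw [← mul_pow]; norm_num
    calc ‖S x‖ = (3/4 : ℝ) ^ j * ((4/3 : ℝ) ^ j * ‖S x‖) := by rw [← mul_assoc, h2, one_mul]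
      _ ≤ _ := by gcongr
  have main : ∀ J : ℕ, ∀ᶠ N in Filter.atTop, ‖μ (J + 2) (ff π N S) 1‖ ≤
      (1 / 642) * (321 - (64 * J + 320) * (3/4 : ℝ) ^ J) := by
    intro J
    induction J with
    | zero =>
      refine Filter.Eventually.of_forall (fun N => ?_)
      have := hF0' N S (1 / 642) (by norm_num) (fun x hx => hS x (Or.inl hx))
      refine this.trans (le_of_eq ?_)
      norm_num
    | succ J ih =>
      filter_upwards [ih, hFE J] with N h1 h2
      have h3 := h2 S ((3/4 : ℝ) ^ J * (1 / 642)) (by positivity) (hSF J)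
      rw [map_one, Module.End.one_apply, LinearMap.sub_apply, Pi.sub_apply, norm_sub_rev] at h3
      have h4 : ‖μ (J + 1 + 2) (ff π N S) 1‖ ≤ ‖μ (J + 2) (ff π N S) 1‖ +
        ‖μ (J + 1 + 2) (ff π N S) 1 - μ (J + 2) (ff π N S) 1‖ := by
        have := norm_add_le (μ (J + 2) (ff π N S) 1) (μ (J + 1 + 2) (ff π N S) 1 - μ (J + 2) (ff π N S) 1)
        simpa using this
      refine h4.trans ((add_le_add h1 h3).trans (le_of_eq ?_))
      push_cast
      ring
  have low : ∀ J : ℕ, 1 / 2 ≤ C / √(3 ^ (J + 2) : ℝ) := by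
    intro J
    obtain ⟨N, h1, h2⟩ := ((main J).and (hC (J + 2))).exists
    have e1 : (T : XX 𝕜 G →ₗ[𝕜] XX 𝕜 G) = S + LinearMap.id := by simp [S]
    rw [e1, ff_add, ff_id, map_add, Pi.add_apply, (muk_avg x1 x2 x3 x4 x5 x6 _).apply_one] at h2
    have h3 : (1 / 642 : ℝ) * (321 - (64 * J + 320) * (3/4 : ℝ) ^ J) ≤ 1 / 2 := by
      have : (0:ℝ) ≤ (64 * J + 320) * (3/4 : ℝ) ^ J := by positivity
      linarith
    have h4 : ‖(1 : 𝕜)‖ ≤ ‖μ (J + 2) (ff π N S) 1 + 1‖ + ‖μ (J + 2) (ff π N S) 1‖ := by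
      have := norm_sub_le (μ (J + 2) (ff π N S) 1 + 1) (μ (J + 2) (ff π N S) 1)
      simpa using this
    rw [norm_one] at h4
    linarith
  have lim : Filter.Tendsto (fun J : ℕ => C / √(3 ^ (J + 2) : ℝ)) Filter.atTop (nhds 0) := by
    refine Filter.Tendsto.div_atTop tendsto_const_nhds ?_
    refine Real.tendsto_sqrt_atTop.comp ?_
    exact (tendsto_pow_atTop_atTop_of_one_lt (by norm_num : (1:ℝ) < 3)).comp (Filter.tendsto_add_atTop_nat 2)
  have := ge_of_tendsto' lim low
  norm_num at this

end A7

section A8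
open Polynomial

abbrev QR (N : ℕ) := RR ⧸ (Ideal.span {(X ^ N : RR)})

instance QR.fin (N : ℕ) : Finite (QR N) := by
  refine Finite.of_surjective (fun a : DL N => Ideal.Quotient.mk (Ideal.span {(X ^ N : RR)}) (a : RR)) ?_
  intro b
  obtain ⟨b, rfl⟩ := Ideal.Quotient.mk_surjective b
  refine ⟨⟨b %ₘ (X ^ N), ?_⟩, ?_⟩
  · rw [mem_degreeLT]
    have := degree_modByMonic_lt b (monic_X_pow (R := ZMod 3) N)
    rwa [degree_X_pow] at this
  · rw [Ideal.Quotient.eq, Ideal.mem_span_singleton]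
    refine ⟨-(b /ₘ X ^ N), ?_⟩
    have := modByMonic_add_div b (X ^ N : RR)
    simp only
    linear_combination this

abbrev GG (N : ℕ) := (Matrix (Fin 3) (Fin 3) (QR N))ˣ
abbrev Gm := (Matrix (Fin 3) (Fin 3) RR)ˣ

instance GG.fin (N : ℕ) : Finite (GG N) := 
  Finite.of_injective (fun u : GG N => (u : Matrix (Fin 3) (Fin 3) (QR N))) Units.val_injective
instance GG.fintype (N : ℕ) : Fintype (GG N) := Fintype.ofFinite _

def ppi (N : ℕ) : Gm →* GG N :=
  Units.map ((Ideal.Quotient.mk (Ideal.span {(X ^ N : RR)})).mapMatrix : _ →+* _).toMonoidHom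

theorem ppi_apply (N : ℕ) (γ : Gm) (i j : Fin 3) :
    (ppi N γ : Matrix (Fin 3) (Fin 3) (QR N)) i j = Ideal.Quotient.mk _ ((γ : Matrix (Fin 3) (Fin 3) RR) i j) := rfl

theorem ppi_res (γ : Gm) (hγ : γ ≠ 1) : ∀ᶠ N in Filter.atTop, ppi N γ ≠ 1 := by
  have : ∃ i j, (γ : Matrix (Fin 3) (Fin 3) RR) i j ≠ (1 : Matrix (Fin 3) (Fin 3) RR) i j := by
    by_contra hcon
    push Not at hcon
    apply hγ
    exact Units.ext (Matrix.ext hcon)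
  obtain ⟨i, j, hij⟩ := this
  filter_upwards [Filter.eventually_gt_atTop
    ((γ : Matrix (Fin 3) (Fin 3) RR) i j - (1 : Matrix (Fin 3) (Fin 3) RR) i j).natDegree] with N hN h1
  have h2 := ppi_apply N γ i j
  have h3 : (1 : Matrix (Fin 3) (Fin 3) (QR N)) i j =
      Ideal.Quotient.mk _ ((1 : Matrix (Fin 3) (Fin 3) RR) i j) := by
    rw [Matrix.one_apply, Matrix.one_apply]
    split_ifs <;> simp
  rw [h1, Units.val_one, h3, eq_comm, Ideal.Quotient.eq, Ideal.mem_span_singleton] at h2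
  have := natDegree_le_of_dvd h2 (sub_ne_zero.mpr hij)
  rw [natDegree_X_pow] at this
  omega

theorem tv_mul {i j : Fin 3} (h : i ≠ j) (a b : RR) :
    (1 + Matrix.single i j a) * (1 + Matrix.single i j b) = (1 + Matrix.single i j (a + b) : Matrix (Fin 3) (Fin 3) RR) := by
  simp only [mul_add, add_mul, mul_one, one_mul]
  rw [Matrix.single_mul_single_of_ne _ _ _ _ h.symm, Matrix.single_add]
  abel

/-- elementary matrices -/
def tv (i j : Fin 3) (h : i ≠ j) (a : RR) : Gm where
  val := 1 + Matrix.single i j a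
  inv := 1 + Matrix.single i j (-a)
  val_inv := by rw [tv_mul h]; simp
  inv_val := by rw [tv_mul h]; simp

theorem tv_val (i j : Fin 3) (h : i ≠ j) (a : RR) : (tv i j h a : Matrix (Fin 3) (Fin 3) RR) = 1 + Matrix.single i j a := rfl

theorem tri_tv (i j k : Fin 3) (hij : i ≠ j) (hik : i ≠ k) (hjk : j ≠ k) :
    Tri (tv i j hij) (tv i k hik) (tv j k hjk) := by
  have ad : ∀ (i j : Fin 3) (h : i ≠ j) (a b : RR), tv i j h (a + b) = tv i j h a * tv i j h b := by
    intro i j h a b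
    apply Units.ext
    rw [Units.val_mul, tv_val, tv_val, tv_val, tv_mul h]
  refine ⟨ad _ _ _, ad _ _ _, ad _ _ _, ?_, ?_, ?_, ?_⟩
  · intro a b
    apply Units.ext
    simp only [Units.val_mul, tv_val, mul_add, add_mul, mul_one, one_mul]
    rw [Matrix.single_mul_single_of_ne _ _ _ _ hij.symm, Matrix.single_mul_single_of_ne _ _ _ _ hik.symm]
    abel
  · intro a b
    apply Units.ext
    simp only [Units.val_mul, tv_val, mul_add, add_mul, mul_one, one_mul]
    rw [Matrix.single_mul_single_of_ne _ _ _ _ hjk.symm, Matrix.single_mul_single_of_ne _ _ _ _ hik.symm]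
    abel
  · refine ⟨1, Or.inl rfl, fun a b => ?_⟩
    apply Units.ext
    simp only [Units.val_mul, tv_val, mul_add, add_mul, mul_one, one_mul]
    rw [Matrix.single_mul_single_of_ne _ _ _ _ hij.symm, Matrix.single_mul_single_of_ne _ _ _ _ hik.symm,
      Matrix.single_mul_single_same]
    simp only [zero_mul]
    rw [Matrix.single_mul_single_of_ne _ _ _ _ hik.symm]
    simp only [add_zero]
    abel
  · intro a b c habc
    have h0 := congrArg (fun u : Gm => (u : Matrix (Fin 3) (Fin 3) RR)) habc
    simp only [Units.val_mul, tv_val, mul_add, add_mul, mul_one, one_mul, Units.val_one] at h0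
    rw [Matrix.single_mul_single_of_ne _ _ _ _ hij.symm, Matrix.single_mul_single_of_ne _ _ _ _ hjk.symm] at h0
    rw [Matrix.single_mul_single_same] at h0
    have e1 := congrFun (congrFun h0 i) j
    have e2 := congrFun (congrFun h0 i) k
    have e3 := congrFun (congrFun h0 j) k
    simp [Matrix.single_apply, hij, hik, hjk, hij.symm, hik.symm, hjk.symm] at e1 e2 e3
    subst e1
    simp at e2
    exact ⟨rfl, e2, e3⟩

theorem sys_tv : Sys (tv 0 1 (by decide)) (tv 0 2 (by decide)) (tv 1 2 (by decide))
    (tv 1 0 (by decide)) (tv 2 0 (by decide)) (tv 2 1 (by decide)) :=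
  ⟨tri_tv 0 1 2 _ _ _, (tri_tv 1 0 2 _ _ _).rev, tri_tv 1 2 0 _ _ _, (tri_tv 2 1 0 _ _ _).rev,
    tri_tv 2 0 1 _ _ _, (tri_tv 0 2 1 _ _ _).rev⟩

theorem not_AP_GG (𝕜 : Type*) [RCLike 𝕜] : ¬ HasAP 𝕜 (XX 𝕜 GG) :=
  not_AP_XX (π := ppi) sys_tv ppi_res

end A8

section B1
variable {𝕜 : Type*} [RCLike 𝕜]

def sg (b : Bool) : ℝ := if b then 1 else -1

theorem exp_mean {G : Type} [Fintype G] [DecidableEq G] (a : G → ℝ) :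
    ∑ ω : G → Bool, Real.exp (∑ g, a g * sg (ω g)) ≤
      Fintype.card (G → Bool) * Real.exp ((∑ g, a g ^ 2) / 2) := by
  have e1 : ∑ ω : G → Bool, Real.exp (∑ g, a g * sg (ω g)) = ∏ g, (2 * Real.cosh (a g)) := by
    simp only [Real.exp_sum]
    have := Finset.prod_univ_sum (fun _ : G => (Finset.univ : Finset Bool)) (fun g b => Real.exp (a g * sg b))
    rw [Fintype.piFinset_univ] at this
    rw [← this]
    refine Finset.prod_congr rfl (fun g _ => ?_)
    rw [Fintype.sum_bool, Real.cosh_eq]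
    simp [sg]
    ring
  rw [e1, Finset.prod_mul_distrib]
  have e2 : ∏ _g : G, (2:ℝ) = Fintype.card (G → Bool) := by simp
  rw [e2]
  gcongr
  rw [Finset.sum_div, Real.exp_sum]
  refine Finset.prod_le_prod (fun g _ => (Real.cosh_pos _).le) (fun g _ => Real.cosh_le_exp_half_sq _)

theorem rpow_le_exp (s : ℝ) (hs : 0 ≤ s) (x : ℝ) (hx : 0 ≤ x) :
    x ^ s ≤ (1 + (⌈s⌉₊).factorial) * Real.exp x := by
  have h1 : (1:ℝ) ≤ Real.exp x := Real.one_le_exp hx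
  have h2 : x ^ ⌈s⌉₊ ≤ (⌈s⌉₊).factorial * Real.exp x := by
    have := Real.pow_div_factorial_le_exp x hx ⌈s⌉₊
    rwa [div_le_iff₀' (by positivity)] at this
  have h3 : x ^ s ≤ 1 + x ^ ⌈s⌉₊ := by
    rcases le_total x 1 with h | h
    · have := Real.rpow_le_one hx h hs
      have : 0 ≤ x ^ ⌈s⌉₊ := by positivity
      linarith
    · have : x ^ s ≤ x ^ (⌈s⌉₊ : ℝ) := Real.rpow_le_rpow_of_exponent_le h (Nat.le_ceil s)
      rw [Real.rpow_natCast] at this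
      linarith
  nlinarith

theorem khin_unit {G : Type} [Fintype G] [DecidableEq G] (s : ℝ) (hs : 0 ≤ s) (a : G → ℝ)
    (ha : ∑ g, a g ^ 2 ≤ 1) :
    ∑ ω : G → Bool, |∑ g, a g * sg (ω g)| ^ s ≤
      Fintype.card (G → Bool) * (2 * (1 + (⌈s⌉₊).factorial) * Real.exp (1 / 2)) := by
  have h1 := exp_mean a
  have h2 := exp_mean (fun g => - a g)
  simp only [neg_sq, neg_mul, Finset.sum_neg_distrib] at h2
  have h3 : Real.exp ((∑ g, a g ^ 2) / 2) ≤ Real.exp (1 / 2) := Real.exp_le_exp.mpr (by linarith)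
  have h4 : ∀ x : ℝ, Real.exp |x| ≤ Real.exp x + Real.exp (-x) := by
    intro x
    rcases abs_choice x with h | h <;> rw [h] <;> nlinarith [Real.exp_pos x, Real.exp_pos (-x)]
  calc ∑ ω : G → Bool, |∑ g, a g * sg (ω g)| ^ s
      ≤ ∑ ω : G → Bool, (1 + (⌈s⌉₊).factorial) * (Real.exp (∑ g, a g * sg (ω g)) +
          Real.exp (-∑ g, a g * sg (ω g))) := by
        refine Finset.sum_le_sum (fun ω _ => (rpow_le_exp s hs _ (abs_nonneg _)).trans ?_)
        gcongr
        exact h4 _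
    _ = (1 + (⌈s⌉₊).factorial) * (∑ ω : G → Bool, Real.exp (∑ g, a g * sg (ω g)) +
          ∑ ω : G → Bool, Real.exp (-∑ g, a g * sg (ω g))) := by
        rw [← Finset.mul_sum, Finset.sum_add_distrib]
    _ ≤ (1 + (⌈s⌉₊).factorial) * (Fintype.card (G → Bool) * Real.exp (1 / 2) +
          Fintype.card (G → Bool) * Real.exp (1 / 2)) := by
        gcongr
        · exact h1.trans (by gcongr)
        · exact h2.trans (by gcongr)
    _ = _ := by ring

theorem khin_real {G : Type} [Fintype G] [DecidableEq G] (s : ℝ) (hs : 0 < s) (a : G → ℝ) (t : ℝ)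
    (ht : 0 ≤ t) (ha : ∑ g, a g ^ 2 ≤ t ^ 2) :
    ∑ ω : G → Bool, |∑ g, a g * sg (ω g)| ^ s ≤
      Fintype.card (G → Bool) * (2 * (1 + (⌈s⌉₊).factorial) * Real.exp (1 / 2)) * t ^ s := by
  rcases ht.eq_or_lt with rfl | ht
  · have h0 : ∀ g, a g = 0 := by
      have h1 : ∑ g, a g ^ 2 = 0 := le_antisymm (by simpa using ha) (by positivity)
      intro g
      have := (Finset.sum_eq_zero_iff_of_nonneg (fun g _ => sq_nonneg (a g))).mp h1 g (Finset.mem_univ g)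
      exact pow_eq_zero_iff (two_ne_zero) |>.mp this
    simp [h0, Real.zero_rpow hs.ne']
  · have h1 := khin_unit s hs.le (fun g => a g / t) (by
      simp only [div_pow]
      rw [← Finset.sum_div, div_le_one (by positivity)]
      exact ha)
    have h2 : ∀ ω : G → Bool, |∑ g, a g / t * sg (ω g)| ^ s = |∑ g, a g * sg (ω g)| ^ s / t ^ s := by
      intro ω
      have : ∑ g, a g / t * sg (ω g) = (∑ g, a g * sg (ω g)) / t := by
        rw [Finset.sum_div]
        exact Finset.sum_congr rfl (fun g _ => by ring)
      rw [this, abs_div, abs_of_pos ht, Real.div_rpow (abs_nonneg _) ht.le]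
    simp only [h2] at h1
    rw [← Finset.sum_div, div_le_iff₀ (by positivity)] at h1
    exact h1

theorem khin (s : ℝ) (hs : 0 < s) : ∃ C : ℝ, 0 ≤ C ∧ ∀ (G : Type) [Fintype G] [DecidableEq G]
    (a : EuclideanSpace 𝕜 G), ∑ ω : G → Bool, ‖∑ g, a g * (sg (ω g) : 𝕜)‖ ^ s ≤
      Fintype.card (G → Bool) * (C * ‖a‖) ^ s := by
  let D : ℝ := 2 * (1 + (⌈s⌉₊).factorial) * Real.exp (1 / 2)
  have hD : 0 ≤ D := by positivity
  refine ⟨2 * (2 * D) ^ (1 / s), by positivity, fun G _ _ a => ?_⟩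
  have hsum : ∑ g, ‖a g‖ ^ 2 = ‖a‖ ^ 2 := (EuclideanSpace.norm_sq_eq a).symm
  have hre := khin_real s hs (fun g => RCLike.re (a g)) ‖a‖ (norm_nonneg _) (by
    rw [← hsum]
    refine Finset.sum_le_sum (fun g _ => ?_)
    rw [← sq_abs]
    gcongr
    exact RCLike.abs_re_le_norm _)
  have him := khin_real s hs (fun g => RCLike.im (a g)) ‖a‖ (norm_nonneg _) (by
    rw [← hsum]
    refine Finset.sum_le_sum (fun g _ => ?_)
    rw [← sq_abs]
    gcongr
    exact RCLike.abs_im_le_norm _)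
  have hpt : ∀ ω : G → Bool, ‖∑ g, a g * (sg (ω g) : 𝕜)‖ ^ s ≤
      2 ^ s * (|∑ g, RCLike.re (a g) * sg (ω g)| ^ s + |∑ g, RCLike.im (a g) * sg (ω g)| ^ s) := by
    intro ω
    set z := ∑ g, a g * (sg (ω g) : 𝕜) with hz
    have e1 : RCLike.re z = ∑ g, RCLike.re (a g) * sg (ω g) := by
      rw [hz, map_sum]
      exact Finset.sum_congr rfl (fun g _ => by simp)
    have e2 : RCLike.im z = ∑ g, RCLike.im (a g) * sg (ω g) := by
      rw [hz, map_sum]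
      exact Finset.sum_congr rfl (fun g _ => by simp)
    rw [← e1, ← e2]
    have h1 : ‖z‖ ≤ |RCLike.re z| + |RCLike.im z| := by
      have q1 := RCLike.norm_sq_eq_def (z := z)
      have q2 := abs_nonneg (RCLike.re z)
      have q3 := abs_nonneg (RCLike.im z)
      have q4 := sq_abs (RCLike.re z)
      have q5 := sq_abs (RCLike.im z)
      refine (abs_le_of_sq_le_sq' ?_ (by positivity)).2
      nlinarith [mul_nonneg q2 q3]
    have h2 : ‖z‖ ≤ 2 * max |RCLike.re z| |RCLike.im z| := by
      have := le_max_left |RCLike.re z| |RCLike.im z|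
      have := le_max_right |RCLike.re z| |RCLike.im z|
      linarith
    calc ‖z‖ ^ s ≤ (2 * max |RCLike.re z| |RCLike.im z|) ^ s := by gcongr
      _ = 2 ^ s * (max |RCLike.re z| |RCLike.im z|) ^ s :=
        Real.mul_rpow (by norm_num) (le_max_of_le_left (abs_nonneg _))
      _ ≤ _ := by
        gcongr
        have p1 : 0 ≤ |RCLike.re z| ^ s := by positivity
        have p2 : 0 ≤ |RCLike.im z| ^ s := by positivity
        rcases max_choice |RCLike.re z| |RCLike.im z| with h | h <;> rw [h] <;> linarith
  calc ∑ ω : G → Bool, ‖∑ g, a g * (sg (ω g) : 𝕜)‖ ^ s ≤ ∑ ω : G → Bool,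
      2 ^ s * (|∑ g, RCLike.re (a g) * sg (ω g)| ^ s + |∑ g, RCLike.im (a g) * sg (ω g)| ^ s) :=
        Finset.sum_le_sum (fun ω _ => hpt ω)
    _ = 2 ^ s * (∑ ω : G → Bool, |∑ g, RCLike.re (a g) * sg (ω g)| ^ s +
        ∑ ω : G → Bool, |∑ g, RCLike.im (a g) * sg (ω g)| ^ s) := by
        rw [← Finset.mul_sum, Finset.sum_add_distrib]
    _ ≤ 2 ^ s * (Fintype.card (G → Bool) * D * ‖a‖ ^ s + Fintype.card (G → Bool) * D * ‖a‖ ^ s) := by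
        gcongr
    _ = _ := by
        rw [Real.mul_rpow (by positivity) (by positivity), Real.mul_rpow (by norm_num) (by positivity),
          ← Real.rpow_mul (by positivity), one_div_mul_cancel hs.ne', Real.rpow_one]
        ring

theorem sg_orth {G : Type} [Fintype G] [DecidableEq G] (g g' : G) :
    ∑ ω : G → Bool, sg (ω g) * sg (ω g') = if g = g' then (Fintype.card (G → Bool) : ℝ) else 0 := by
  have hsq : ∀ b, sg b * sg b = 1 := by intro b; cases b <;> simp [sg]
  split_ifs with h
  · subst h
    simp [hsq]
  · have : ∑ ω : G → Bool, sg (ω g) * sg (ω g') = -∑ ω : G → Bool, sg (ω g) * sg (ω g') := by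
      rw [← Finset.sum_neg_distrib]
      have hinv : Function.Involutive (fun ω : G → Bool => Function.update ω g (!(ω g))) := by
        intro ω
        simp
      refine Fintype.sum_equiv hinv.toPerm _ _ (fun ω => ?_)
      simp only [Function.Involutive.coe_toPerm, Function.update_self, Function.update_of_ne (Ne.symm h)]
      cases ω g <;> cases ω g' <;> simp [sg]
    linarith

theorem block (q : ℝ) (hq : 1 < q) : ∃ C : ℝ, 0 ≤ C ∧ ∀ (G : Type) [Fintype G], ∃ (Ω : Type) (_ : Fintype Ω)
    (i : EuclideanSpace 𝕜 G →ₗ[𝕜] (Ω → 𝕜)) (f : (Ω → 𝕜) →ₗ[𝕜] EuclideanSpace 𝕜 G),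
    (∀ a, ∑ ω, ‖i a ω‖ ^ q ≤ (C * ‖a‖) ^ q) ∧ (∀ x, ‖f x‖ ≤ C * (∑ ω, ‖x ω‖ ^ q) ^ (1 / q)) ∧
    ∀ a, f (i a) = a := by
  have hconj : q.HolderConjugate (q.conjExponent) := Real.HolderConjugate.conjExponent hq
  set q' := q.conjExponent
  obtain ⟨C1, hC1, h1⟩ := khin (𝕜 := 𝕜) q hconj.pos
  obtain ⟨C2, hC2, h2⟩ := khin (𝕜 := 𝕜) q' hconj.symm.pos
  refine ⟨max C1 C2, le_max_of_le_left hC1, fun G _ => ?_⟩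
  classical
  let K : ℝ := Fintype.card (G → Bool)
  have hK : 0 < K := by
    simp only [K]
    exact_mod_cast Fintype.card_pos
  let i : EuclideanSpace 𝕜 G →ₗ[𝕜] ((G → Bool) → 𝕜) :=
    { toFun := fun a ω => ((K ^ (-(1 / q)) : ℝ) : 𝕜) * ∑ g, a g * (sg (ω g) : 𝕜)
      map_add' := by
        intro a b
        funext ω
        simp [add_mul, Finset.sum_add_distrib, mul_add]
      map_smul' := by
        intro c a
        funext ω
        simp [Finset.mul_sum, mul_left_comm, mul_assoc] }
  let f : ((G → Bool) → 𝕜) →ₗ[𝕜] EuclideanSpace 𝕜 G :=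
    { toFun := fun x => WithLp.toLp 2 (fun g => ((K ^ (-(1 / q')) : ℝ) : 𝕜) * ∑ ω, (sg (ω g) : 𝕜) * x ω)
      map_add' := by
        intro a b
        ext g
        simp [Finset.sum_add_distrib, mul_add]
      map_smul' := by
        intro c a
        ext g
        simp [Finset.mul_sum, mul_left_comm] }
  have hi : ∀ a ω, i a ω = ((K ^ (-(1 / q)) : ℝ) : 𝕜) * ∑ g, a g * (sg (ω g) : 𝕜) := fun _ _ => rfl
  have hf : ∀ x g, f x g = ((K ^ (-(1 / q')) : ℝ) : 𝕜) * ∑ ω, (sg (ω g) : 𝕜) * x ω := fun _ _ => rfl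
  refine ⟨G → Bool, inferInstance, i, f, ?_, ?_, ?_⟩
  · intro a
    have e1 : ∀ ω, ‖i a ω‖ ^ q = K⁻¹ * ‖∑ g, a g * (sg (ω g) : 𝕜)‖ ^ q := by
      intro ω
      rw [hi, norm_mul, RCLike.norm_ofReal, abs_of_nonneg (by positivity), Real.mul_rpow (by positivity) (by positivity),
        ← Real.rpow_mul hK.le, neg_mul, one_div_mul_cancel hconj.pos.ne', Real.rpow_neg_one]
    simp only [e1]
    rw [← Finset.mul_sum, inv_mul_le_iff₀ hK]
    refine (h1 G a).trans ?_
    have := hconj.pos.le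
    gcongr
    exact le_max_left _ _
  · intro x
    have hq0 := hconj.symm.pos
    -- duality
    have key : ∀ b : EuclideanSpace 𝕜 G, ‖∑ g, b g * f x g‖ ≤ C2 * ‖b‖ * (∑ ω, ‖x ω‖ ^ q) ^ (1 / q) := by
      intro b
      have e1 : ∑ g, b g * f x g = ((K ^ (-(1 / q')) : ℝ) : 𝕜) * ∑ ω, (∑ g, b g * (sg (ω g) : 𝕜)) * x ω := by
        simp only [hf, Finset.mul_sum, Finset.sum_mul]
        rw [Finset.sum_comm]
        refine Finset.sum_congr rfl (fun ω _ => Finset.sum_congr rfl (fun g _ => ?_))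
        ring
      rw [e1, norm_mul, RCLike.norm_ofReal, abs_of_nonneg (by positivity)]
      have e2 : ‖∑ ω : G → Bool, (∑ g, b g * (sg (ω g) : 𝕜)) * x ω‖ ≤
          (∑ ω : G → Bool, ‖∑ g, b g * (sg (ω g) : 𝕜)‖ ^ q') ^ (1 / q') * (∑ ω, ‖x ω‖ ^ q) ^ (1 / q) := by
        refine (norm_sum_le _ _).trans ?_
        simp only [norm_mul]
        exact Real.inner_le_Lp_mul_Lq_of_nonneg _ hconj.symm (fun _ _ => norm_nonneg _) (fun _ _ => norm_nonneg _)
      have e3 : (∑ ω : G → Bool, ‖∑ g, b g * (sg (ω g) : 𝕜)‖ ^ q') ^ (1 / q') ≤ K ^ (1 / q') * (C2 * ‖b‖) := by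
        calc _ ≤ (K * (C2 * ‖b‖) ^ q') ^ (1 / q') := by
              gcongr
              exact h2 G b
          _ = _ := by
              rw [Real.mul_rpow hK.le (by positivity), ← Real.rpow_mul (by positivity),
                mul_one_div_cancel hq0.ne', Real.rpow_one]
      calc K ^ (-(1 / q')) * ‖∑ ω, (∑ g, b g * (sg (ω g) : 𝕜)) * x ω‖ ≤
          K ^ (-(1 / q')) * ((K ^ (1 / q') * (C2 * ‖b‖)) * (∑ ω, ‖x ω‖ ^ q) ^ (1 / q)) := by
            gcongr
            exact e2.trans (by gcongr)
        _ = (K ^ (-(1 / q')) * K ^ (1 / q')) * (C2 * ‖b‖ * (∑ ω, ‖x ω‖ ^ q) ^ (1 / q)) := by ring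
        _ = _ := by
            rw [← Real.rpow_add hK, neg_add_cancel, Real.rpow_zero, one_mul]
    have k1 := key (WithLp.toLp 2 (fun g => (starRingEnd 𝕜) (f x g)))
    have e4 : ∑ g, (WithLp.toLp 2 (fun g => (starRingEnd 𝕜) (f x g)) : EuclideanSpace 𝕜 G) g * f x g =
        ((‖f x‖ ^ 2 : ℝ) : 𝕜) := by
      rw [EuclideanSpace.norm_sq_eq]
      push_cast
      refine Finset.sum_congr rfl (fun g _ => ?_)
      rw [RCLike.conj_mul]
    have e5 : ‖(WithLp.toLp 2 (fun g => (starRingEnd 𝕜) (f x g)) : EuclideanSpace 𝕜 G)‖ = ‖f x‖ := by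
      rw [EuclideanSpace.norm_eq, EuclideanSpace.norm_eq]
      simp
    rw [e4, e5, RCLike.norm_ofReal, abs_of_nonneg (by positivity)] at k1
    have k2 : ‖f x‖ ≤ C2 * (∑ ω, ‖x ω‖ ^ q) ^ (1 / q) := by
      rcases (norm_nonneg (f x)).eq_or_lt with h0 | h0
      · rw [← h0]; positivity
      · nlinarith
    refine k2.trans ?_
    gcongr
    exact le_max_right _ _
  · intro a
    ext g
    rw [hf]
    simp only [hi]
    have hK2 : K ^ (-(1 / q')) * K ^ (-(1 / q)) = K⁻¹ := by
      rw [← Real.rpow_add hK, ← Real.rpow_neg_one]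
      congr 1
      have := hconj.inv_add_inv_eq_one
      simp only [one_div]
      linarith
    have e1 : ∑ ω : G → Bool, (sg (ω g) : 𝕜) * (((K ^ (-(1 / q)) : ℝ) : 𝕜) * ∑ g, a g * (sg (ω g) : 𝕜)) =
        ((K ^ (-(1 / q)) : ℝ) : 𝕜) * (a g * (K : 𝕜)) := by
      have : ∀ g', ∑ ω : G → Bool, (sg (ω g) : 𝕜) * (sg (ω g') : 𝕜) = if g = g' then (K : 𝕜) else 0 := by
        intro g'
        have := congrArg (fun t : ℝ => (t : 𝕜)) (sg_orth g g')
        push_cast at this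
        rw [this]
        split_ifs <;> simp [K]
      calc _ = ((K ^ (-(1 / q)) : ℝ) : 𝕜) * ∑ g', a g' * ∑ ω : G → Bool, (sg (ω g) : 𝕜) * (sg (ω g') : 𝕜) := by
            simp only [Finset.mul_sum]
            rw [Finset.sum_comm]
            refine Finset.sum_congr rfl (fun ω _ => Finset.sum_congr rfl (fun g _ => ?_))
            ring
        _ = _ := by
            simp [this]
    rw [e1, ← mul_assoc, ← RCLike.ofReal_mul, hK2]
    have hK0 : (K : 𝕜) ≠ 0 := by exact_mod_cast hK.ne'
    push_cast
    field_simp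

end B1

section B2
variable {𝕜 : Type*} [RCLike 𝕜]

theorem prod_sum_bd {n : ℕ} (hn : n ≠ 0) (β : ℕ → Fin n → ℝ) (h0 : ∀ N l, 0 ≤ β N l) (w : Fin n → ℝ)
    (hw : ∀ l, 0 ≤ w l) (h : ∀ l, ∀ F : Finset ℕ, ∑ N ∈ F, β N l ^ n ≤ w l ^ n) (F : Finset ℕ) :
    ∑ N ∈ F, ∏ l, β N l ≤ n * ∏ l, w l := by
  by_cases hz : ∃ l, w l = 0
  · obtain ⟨l, hl⟩ := hz
    have hb : ∀ N, β N l = 0 := by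
      intro N
      have := h l {N}
      rw [Finset.sum_singleton, hl, zero_pow hn] at this
      exact pow_eq_zero_iff hn |>.1 (le_antisymm this (pow_nonneg (h0 N l) n))
    have : ∀ N ∈ F, ∏ l, β N l = 0 := fun N _ => Finset.prod_eq_zero (Finset.mem_univ l) (hb N)
    rw [Finset.sum_eq_zero this]
    exact mul_nonneg (Nat.cast_nonneg _) (Finset.prod_nonneg fun l _ => hw l)
  · push Not at hz
    have hw' : ∀ l, 0 < w l := fun l => lt_of_le_of_ne (hw l) (hz l).symm
    have : Nonempty (Fin n) := ⟨⟨0, Nat.pos_of_ne_zero hn⟩⟩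
    have key : ∀ N, ∏ l, β N l ≤ (∏ l, w l) * ∑ l, (β N l / w l) ^ n := by
      intro N
      have e : ∏ l, β N l = (∏ l, w l) * ∏ l, (β N l / w l) := by
        rw [← Finset.prod_mul_distrib]
        exact Finset.prod_congr rfl fun l _ => by rw [mul_div_cancel₀ _ (hz l)]
      rw [e]
      refine mul_le_mul_of_nonneg_left ?_ (Finset.prod_nonneg fun l _ => hw l)
      have hx : ∀ l, 0 ≤ β N l / w l := fun l => div_nonneg (h0 N l) (hw l)
      obtain ⟨l0, hl0⟩ := Finite.exists_max (fun l => β N l / w l)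
      calc ∏ l, (β N l / w l) ≤ ∏ _l : Fin n, (β N l0 / w l0) :=
            Finset.prod_le_prod (fun l _ => hx l) (fun l _ => hl0 l)
        _ = (β N l0 / w l0) ^ n := by rw [Finset.prod_const, Finset.card_univ, Fintype.card_fin]
        _ ≤ _ := Finset.single_le_sum (f := fun l => (β N l / w l) ^ n)
            (fun l _ => pow_nonneg (hx l) n) (Finset.mem_univ l0)
    calc ∑ N ∈ F, ∏ l, β N l ≤ ∑ N ∈ F, (∏ l, w l) * ∑ l, (β N l / w l) ^ n :=
          Finset.sum_le_sum fun N _ => key N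
      _ = (∏ l, w l) * ∑ l, ∑ N ∈ F, (β N l / w l) ^ n := by
          rw [← Finset.mul_sum, Finset.sum_comm]
      _ ≤ (∏ l, w l) * ∑ _l : Fin n, 1 := by
          refine mul_le_mul_of_nonneg_left ?_ (Finset.prod_nonneg fun l _ => hw l)
          refine Finset.sum_le_sum fun l _ => ?_
          simp only [div_pow]
          rw [← Finset.sum_div, div_le_one (pow_pos (hw' l) n)]
          exact h l F
      _ = _ := by simp [mul_comm]

theorem sumJ0 {X E : Type*} [NormedAddCommGroup X] [NormedSpace 𝕜 X] [NormedAddCommGroup E] [NormedSpace 𝕜 E]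
    {n : ℕ} (hn : n ≠ 0) (T : ℕ → X →ₗ[𝕜] MultilinearMap 𝕜 (fun _ : Fin n => E) 𝕜) (β : ℕ → E → ℝ)
    (hβ : ∀ N v, 0 ≤ β N v) (C : ℝ) (hC : 0 ≤ C) (hsum : ∀ v, ∀ F : Finset ℕ, ∑ N ∈ F, β N v ^ n ≤ (C * ‖v‖) ^ n)
    (hT : ∀ N S v, ‖T N S v‖ ≤ ‖S‖ * ∏ l, β N (v l)) :
    ∃ J : X →L[𝕜] ContinuousMultilinearMap 𝕜 (fun _ : Fin n => E) 𝕜, ∀ S v, J S v = ∑' N, T N S v := by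
  have hfin : ∀ S v, ∀ F : Finset ℕ, ∑ N ∈ F, ‖T N S v‖ ≤ (n * C ^ n) * ‖S‖ * ∏ l, ‖v l‖ := by
    intro S v F
    calc ∑ N ∈ F, ‖T N S v‖ ≤ ∑ N ∈ F, ‖S‖ * ∏ l, β N (v l) := Finset.sum_le_sum fun N _ => hT N S v
      _ = ‖S‖ * ∑ N ∈ F, ∏ l, β N (v l) := by rw [← Finset.mul_sum]
      _ ≤ ‖S‖ * (n * ∏ l, (C * ‖v l‖)) := by
          refine mul_le_mul_of_nonneg_left ?_ (norm_nonneg _)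
          exact prod_sum_bd hn (fun N l => β N (v l)) (fun N l => hβ _ _) _ (fun l => by positivity)
            (fun l F => hsum (v l) F) F
      _ = _ := by
          rw [Finset.prod_mul_distrib]
          simp
          ring
  have hsm' : ∀ S v, Summable fun N => ‖T N S v‖ := fun S v =>
    summable_of_sum_le (fun _ => norm_nonneg _) (hfin S v)
  have hsm : ∀ S v, Summable fun N => T N S v := fun S v => (hsm' S v).of_norm
  have hbd : ∀ S v, ‖∑' N, T N S v‖ ≤ (n * C ^ n) * ‖S‖ * ∏ l, ‖v l‖ := fun S v =>
    (norm_tsum_le_tsum_norm (hsm' S v)).trans ((hsm' S v).tsum_le_of_sum_le (hfin S v))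
  let M0 : X → MultilinearMap 𝕜 (fun _ : Fin n => E) 𝕜 := fun S =>
    { toFun := fun v => ∑' N, T N S v
      map_update_add' := by
        intro _ v l x y
        simp only [MultilinearMap.map_update_add]
        exact (hsm S _).tsum_add (hsm S _)
      map_update_smul' := by
        intro _ v l c x
        simp only [MultilinearMap.map_update_smul, smul_eq_mul]
        exact tsum_mul_left }
  let M1 : X →ₗ[𝕜] ContinuousMultilinearMap 𝕜 (fun _ : Fin n => E) 𝕜 :=
    { toFun := fun S => (M0 S).mkContinuous ((n * C ^ n) * ‖S‖) (hbd S)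
      map_add' := by
        intro S S'
        ext v
        change ∑' N, T N (S + S') v = ∑' N, T N S v + ∑' N, T N S' v
        simp only [map_add, add_apply]
        exact (hsm S _).tsum_add (hsm S' _)
      map_smul' := by
        intro c S
        ext v
        change ∑' N, T N (c • S) v = c • ∑' N, T N S v
        simp only [map_smul, smul_apply, smul_eq_mul]
        exact tsum_mul_left }
  refine ⟨M1.mkContinuous (n * C ^ n) (fun S => ?_), fun S v => rfl⟩
  exact MultilinearMap.mkContinuous_norm_le (M0 S) (by positivity) (hbd S)

theorem symJ {X E : Type*} [NormedAddCommGroup X] [NormedSpace 𝕜 X] [NormedAddCommGroup E] [NormedSpace 𝕜 E]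
    {n : ℕ} (J : X →L[𝕜] ContinuousMultilinearMap 𝕜 (fun _ : Fin n => E) 𝕜) :
    ∃ J' : X →L[𝕜] HomPoly 𝕜 n E 𝕜, ∀ S v, (J' S).1 v = ∑ σ : Equiv.Perm (Fin n), J S (v ∘ σ) := by
  have key : ∀ S, ∃ P : HomPoly 𝕜 n E 𝕜, (∀ v, P.1 v = ∑ σ : Equiv.Perm (Fin n), J S (v ∘ σ)) := by
    intro S
    refine ⟨⟨∑ σ : Equiv.Perm (Fin n), (J S).domDomCongr σ, ?_⟩, ?_⟩
    · intro τ v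
      simp only [sum_apply, ContinuousMultilinearMap.domDomCongr_apply]
      exact Fintype.sum_equiv (Equiv.mulLeft τ) _ _ (fun σ => rfl)
    · intro v
      simp only [sum_apply, ContinuousMultilinearMap.domDomCongr_apply]
      rfl
  choose P hP using key
  let L : X →ₗ[𝕜] HomPoly 𝕜 n E 𝕜 :=
    { toFun := P
      map_add' := by
        intro S S'
        apply Subtype.ext
        ext v
        change (P (S + S')).1 v = (P S).1 v + (P S').1 v
        rw [hP, hP, hP, ← Finset.sum_add_distrib]
        simp
      map_smul' := by
        intro c S
        apply Subtype.ext
        ext v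
        change (P (c • S)).1 v = c • (P S).1 v
        rw [hP, hP, Finset.smul_sum]
        simp }
  refine ⟨L.mkContinuous (Fintype.card (Equiv.Perm (Fin n)) * ‖J‖) (fun S => ?_), fun S v => hP S v⟩
  change ‖(P S).1‖ ≤ _
  refine ContinuousMultilinearMap.opNorm_le_bound (by positivity) (fun v => ?_)
  rw [hP]
  refine (norm_sum_le _ _).trans ?_
  calc ∑ σ : Equiv.Perm (Fin n), ‖J S (v ∘ σ)‖ ≤ ∑ σ : Equiv.Perm (Fin n), ‖J‖ * ‖S‖ * ∏ l, ‖v l‖ := by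
        refine Finset.sum_le_sum fun σ _ => ?_
        refine ((J S).le_opNorm _).trans ?_
        have : ∏ l, ‖(v ∘ σ) l‖ = ∏ l, ‖v l‖ := Equiv.prod_comp σ (fun l => ‖v l‖)
        rw [this]
        gcongr
        exact J.le_opNorm S
    _ = _ := by
        simp
        ring

theorem lpQ {Y : Type*} [NormedAddCommGroup Y] [NormedSpace 𝕜 Y] {F : ℕ → Type*} [∀ N, NormedAddCommGroup (F N)]
    [∀ N, NormedSpace 𝕜 (F N)] (q : ∀ N, Y →ₗ[𝕜] F N) (K : ℝ) (hK : 0 ≤ K) (h : ∀ N y, ‖q N y‖ ≤ K * ‖y‖) :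
    ∃ Q : Y →L[𝕜] lp F ∞, ∀ y N, Q y N = q N y := by
  let L : Y →ₗ[𝕜] lp F ∞ :=
    { toFun := fun y => ⟨fun N => q N y, memℓp_infty ⟨K * ‖y‖, by rintro _ ⟨N, rfl⟩; exact h N y⟩⟩
      map_add' := by
        intro y y'
        ext N
        exact map_add (q N) y y'
      map_smul' := by
        intro c y
        ext N
        exact map_smul (q N) c y }
  exact ⟨L.mkContinuous K (fun y => lp.norm_le_of_forall_le (by positivity) (fun N => h N y)), fun y N => rfl⟩

theorem prodM {V W E : Type*} [AddCommGroup V] [Module 𝕜 V] [AddCommGroup W] [Module 𝕜 W] [AddCommGroup E] [Module 𝕜 E]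
    {m : ℕ} (S : V →ₗ[𝕜] W →ₗ[𝕜] 𝕜) (f : E →ₗ[𝕜] V) (g : E →ₗ[𝕜] W) (φ : E →ₗ[𝕜] 𝕜) :
    ∃ T : MultilinearMap 𝕜 (fun _ : Fin (m + 2) => E) 𝕜,
      ∀ v, T v = S (f (v 0)) (g (v 1)) * ∏ l : Fin m, φ (v l.succ.succ) := by
  let P : MultilinearMap 𝕜 (fun _ : Fin m => E) 𝕜 :=
    (MultilinearMap.mkPiAlgebra 𝕜 (Fin m) 𝕜).compLinearMap (fun _ => φ)
  let B : E →ₗ[𝕜] E →ₗ[𝕜] MultilinearMap 𝕜 (fun _ : Fin m => E) 𝕜 :=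
    LinearMap.mk₂ 𝕜 (fun x y => S (f x) (g y) • P)
      (by intros; simp [add_smul]) (by intros; simp [mul_smul])
      (by intros; simp [add_smul]) (by intros; simp [mul_smul])
  let B' : E →ₗ[𝕜] MultilinearMap 𝕜 (fun _ : Fin (m + 1) => E) 𝕜 :=
    (multilinearCurryLeftEquiv 𝕜 (fun _ : Fin (m + 1) => E) 𝕜).symm.toLinearMap ∘ₗ B
  refine ⟨B'.uncurryLeft, fun v => ?_⟩
  rfl

theorem bilQ {V W E : Type*} [NormedAddCommGroup V] [NormedSpace 𝕜 V] [NormedAddCommGroup W] [NormedSpace 𝕜 W]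
    [NormedAddCommGroup E] [NormedSpace 𝕜 E] {m : ℕ} (i : V →ₗ[𝕜] E) (j : W →ₗ[𝕜] E) (o : E) (C : ℝ) (hC : 0 ≤ C)
    (hi : ∀ a, ‖i a‖ ≤ C * ‖a‖) (hj : ∀ b, ‖j b‖ ≤ C * ‖b‖) (ho : ‖o‖ ≤ C) :
    ∃ q : HomPoly 𝕜 (m + 2) E 𝕜 →ₗ[𝕜] (V →L[𝕜] W →L[𝕜] 𝕜), (∀ M a b, q M a b =
      M.1 (Fin.cons (i a) (Fin.cons (j b) (fun _ => o) : Fin (m + 1) → E) : Fin (m + 2) → E)) ∧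
      ∀ M, ‖q M‖ ≤ (C * C * C ^ m) * ‖M‖ := by
  have hbd : ∀ (M : HomPoly 𝕜 (m + 2) E 𝕜) a b,
      ‖M.1 (Fin.cons (i a) (Fin.cons (j b) (fun _ => o) : Fin (m + 1) → E) : Fin (m + 2) → E)‖ ≤
      (C * C * C ^ m * ‖M‖) * ‖a‖ * ‖b‖ := by
    intro M a b
    refine (M.1.le_opNorm _).trans ?_
    rw [Fin.prod_univ_succ, Fin.prod_univ_succ]
    simp only [Fin.cons_zero, Fin.cons_succ, Finset.prod_const, Finset.card_univ, Fintype.card_fin]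
    change ‖M‖ * _ ≤ _
    calc ‖M‖ * (‖i a‖ * (‖j b‖ * ‖o‖ ^ m)) ≤ ‖M‖ * ((C * ‖a‖) * ((C * ‖b‖) * C ^ m)) := by
          gcongr
          · exact hi a
          · exact hj b
      _ = _ := by ring
  have h0 : ∀ M : HomPoly 𝕜 (m + 2) E 𝕜, ∃ q : V →L[𝕜] W →L[𝕜] 𝕜, (∀ a b, q a b =
      M.1 (Fin.cons (i a) (Fin.cons (j b) (fun _ => o) : Fin (m + 1) → E) : Fin (m + 2) → E)) ∧
      ‖q‖ ≤ (C * C * C ^ m) * ‖M‖ := by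
    intro M
    let MM := M.1.toMultilinearMap
    let B : V →ₗ[𝕜] W →ₗ[𝕜] 𝕜 := LinearMap.mk₂ 𝕜
      (fun a b => ((MM.curryLeft (i a)).curryLeft (j b)) (fun _ => o))
      (by intros; simp only [map_add]; rfl)
      (by intros; simp only [map_smul]; rfl)
      (by intros; simp only [map_add, add_apply])
      (by intros; simp only [map_smul, smul_apply])
    exact ⟨B.mkContinuous₂ _ (hbd M), fun a b => rfl, LinearMap.mkContinuous₂_norm_le _ (by positivity) _⟩
  choose q hq hqn using h0
  refine ⟨{ toFun := q, map_add' := ?_, map_smul' := ?_ }, hq, hqn⟩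
  · intro M M'
    ext a b
    change q (M + M') a b = q M a b + q M' a b
    rw [hq, hq, hq]
    rfl
  · intro c M
    ext a b
    change q (c • M) a b = c • q M a b
    rw [hq, hq]
    rfl

end B2

section B3
variable {𝕜 : Type*} [RCLike 𝕜]

theorem HasAP.of_retract_smul {X Y : Type*} [NormedAddCommGroup X] [NormedSpace 𝕜 X] [NormedAddCommGroup Y]
    [NormedSpace 𝕜 Y] (J : X →L[𝕜] Y) (Q : Y →L[𝕜] X) (c : 𝕜) (hc : c ≠ 0) (h : ∀ x, Q (J x) = c • x)
    (hY : HasAP 𝕜 Y) : HasAP 𝕜 X :=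
  HasAP.of_retract 𝕜 J (c⁻¹ • Q) (fun x => by
    change c⁻¹ • Q (J x) = x
    rw [h, smul_smul, inv_mul_cancel₀ hc, one_smul]) hY

theorem TT {G : ℕ → Type} [∀ N, Fintype (G N)] {E : Type*} [NormedAddCommGroup E] [NormedSpace 𝕜 E] {m : ℕ} (N : ℕ)
    (f g : E →ₗ[𝕜] EuclideanSpace 𝕜 (G N)) (φ : E →ₗ[𝕜] 𝕜) :
    ∃ T : XX 𝕜 G →ₗ[𝕜] MultilinearMap 𝕜 (fun _ : Fin (m + 2) => E) 𝕜,
      ∀ S v, T S v = S N (f (v 0)) (g (v 1)) * ∏ l : Fin m, φ (v l.succ.succ) := by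
  have h : ∀ s : Bil 𝕜 (G N), ∃ T : MultilinearMap 𝕜 (fun _ : Fin (m + 2) => E) 𝕜,
      ∀ v, T v = s (f (v 0)) (g (v 1)) * ∏ l : Fin m, φ (v l.succ.succ) := fun s =>
    prodM (LinearMap.mk₂ 𝕜 (fun a b => s a b) (by simp) (by simp) (by simp) (by simp)) f g φ
  choose T hT using h
  refine ⟨{ toFun := fun S => T (S N), map_add' := ?_, map_smul' := ?_ }, fun S v => hT _ v⟩
  · intro S S'
    ext v
    rw [add_apply, hT, hT, hT, ← add_mul]
    rfl
  · intro c S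
    ext v
    rw [smul_apply, hT, hT]
    exact mul_assoc c _ _

set_option maxHeartbeats 2000000 in
theorem retract {G : ℕ → Type} [∀ N, Fintype (G N)] {E : Type*} [NormedAddCommGroup E] [NormedSpace 𝕜 E] {m : ℕ}
    (f g : ∀ N, E →ₗ[𝕜] EuclideanSpace 𝕜 (G N)) (φ : ℕ → E →ₗ[𝕜] 𝕜)
    (i j : ∀ N, EuclideanSpace 𝕜 (G N) →ₗ[𝕜] E) (o : ℕ → E) (C : ℝ) (hC : 0 ≤ C)
    (hi : ∀ N a, ‖i N a‖ ≤ C * ‖a‖) (hj : ∀ N a, ‖j N a‖ ≤ C * ‖a‖) (ho : ∀ N, ‖o N‖ ≤ C)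
    (β : ℕ → E → ℝ) (hβ : ∀ N v, 0 ≤ β N v)
    (hf : ∀ N v, ‖f N v‖ ≤ β N v) (hg : ∀ N v, ‖g N v‖ ≤ β N v) (hφ : ∀ N v, ‖φ N v‖ ≤ β N v)
    (hsum : ∀ v, ∀ F : Finset ℕ, ∑ N ∈ F, β N v ^ (m + 2) ≤ (C * ‖v‖) ^ (m + 2))
    (hfi : ∀ N a, f N (i N a) = a) (hfj : ∀ N a, f N (j N a) = 0) (hfo : ∀ N, f N (o N) = 0)
    (hgj : ∀ N a, g N (j N a) = a) (hgo : ∀ N, g N (o N) = 0) (hφo : ∀ N, φ N (o N) = 1)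
    (hfi' : ∀ M N a, M ≠ N → f M (i N a) = 0) (hfj' : ∀ M N a, M ≠ N → f M (j N a) = 0)
    (hfo' : ∀ M N, M ≠ N → f M (o N) = 0)
    (h : HasAP 𝕜 (HomPoly 𝕜 (m + 2) E 𝕜)) : HasAP 𝕜 (XX 𝕜 G) := by
  classical
  choose T hT using fun N => TT (𝕜 := 𝕜) (G := G) (m := m) N (f N) (g N) (φ N)
  have hTb : ∀ N S v, ‖T N S v‖ ≤ ‖S‖ * ∏ l, β N (v l) := by
    intro N S v
    rw [hT, Fin.prod_univ_succ, Fin.prod_univ_succ, norm_mul, norm_prod]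
    have h1 : ‖S N (f N (v 0)) (g N (v 1))‖ ≤ ‖S‖ * β N (v 0) * β N (v 1) := by
      refine (bil_apply_le _ _ _).trans ?_
      have := lp.norm_apply_le_norm (ENNReal.top_ne_zero) S N
      have := hβ N (v 0)
      have := hf N (v 0)
      have := hg N (v 1)
      gcongr
    have h2 : ∏ l : Fin m, ‖φ N (v l.succ.succ)‖ ≤ ∏ l : Fin m, β N (v l.succ.succ) :=
      Finset.prod_le_prod (fun _ _ => norm_nonneg _) (fun _ _ => hφ _ _)
    calc _ ≤ (‖S‖ * β N (v 0) * β N (v 1)) * ∏ l : Fin m, β N (v l.succ.succ) :=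
          mul_le_mul h1 h2 (Finset.prod_nonneg fun _ _ => norm_nonneg _) (by
            have := hβ N (v 0)
            have := hβ N (v 1)
            positivity)
      _ = _ := by
          rw [mul_assoc, mul_assoc]
          rfl
  obtain ⟨J0, hJ0⟩ := sumJ0 (Nat.succ_ne_zero (m + 1)) T β hβ C hC hsum hTb
  obtain ⟨J, hJ⟩ := symJ J0
  choose q hq hqn using fun N => bilQ (𝕜 := 𝕜) (m := m) (i N) (j N) (o N) C hC (hi N) (hj N) (ho N)
  obtain ⟨Q, hQ⟩ := lpQ (𝕜 := 𝕜) (Y := HomPoly 𝕜 (m + 2) E 𝕜) (F := fun N => Bil 𝕜 (G N)) q (C * C * C ^ m) (by positivity) hqn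
  let A : Finset (Equiv.Perm (Fin (m + 2))) := Finset.univ.filter fun σ => σ 0 = 0 ∧ σ 1 = 1
  have hA : (A.card : 𝕜) ≠ 0 := by
    have : A.Nonempty := ⟨1, by simp [A]⟩
    exact_mod_cast this.card_pos.ne'
  have key : ∀ S N a b, (J S).1 (Fin.cons (i N a) (Fin.cons (j N b) (fun _ => o N) : Fin (m + 1) → E) :
      Fin (m + 2) → E) = A.card * S N a b := by
    intro S N a b
    set u : Fin (m + 2) → E := Fin.cons (i N a) (Fin.cons (j N b) (fun _ => o N) : Fin (m + 1) → E) with hu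
    have u0 : u 0 = i N a := rfl
    have u1 : u 1 = j N b := rfl
    have us : ∀ l : Fin m, u l.succ.succ = o N := fun l => rfl
    have F0 : ∀ M, M ≠ N → ∀ k, f M (u k) = 0 := by
      intro M hM k
      refine Fin.cases ?_ (fun k => Fin.cases ?_ (fun k => ?_) k) k
      · exact hfi' M N a hM
      · exact hfj' M N b hM
      · exact hfo' M N hM
    have F1 : ∀ k, k ≠ 0 → f N (u k) = 0 := by
      intro k
      refine Fin.cases ?_ (fun k => Fin.cases ?_ (fun k => ?_) k) k
      · intro h; exact absurd rfl h
      · intro _; exact hfj N b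
      · intro _; exact hfo N
    have G1 : ∀ k, k ≠ 0 → k ≠ 1 → g N (u k) = 0 := by
      intro k
      refine Fin.cases ?_ (fun k => Fin.cases ?_ (fun k => ?_) k) k
      · intro h; exact absurd rfl h
      · intro _ h; exact absurd rfl h
      · intro _ _; exact hgo N
    have P1 : ∀ k, k ≠ 0 → k ≠ 1 → φ N (u k) = 1 := by
      intro k
      refine Fin.cases ?_ (fun k => Fin.cases ?_ (fun k => ?_) k) k
      · intro h; exact absurd rfl h
      · intro _ h; exact absurd rfl h
      · intro _ _; exact hφo N
    have e1 : ∀ σ : Equiv.Perm (Fin (m + 2)), J0 S (u ∘ σ) = if σ ∈ A then S N a b else 0 := by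
      intro σ
      rw [hJ0, tsum_eq_single N]
      · rw [hT]
        simp only [Function.comp_apply]
        by_cases h0 : σ 0 = 0
        · by_cases h1 : σ 1 = 1
          · have hσ : σ ∈ A := by simp [A, h0, h1]
            rw [if_pos hσ, h0, h1, u0, u1, hfi, hgj]
            have : ∀ l : Fin m, φ N (u (σ l.succ.succ)) = 1 := by
              intro l
              refine P1 _ ?_ ?_
              · intro hh
                exact Fin.succ_ne_zero _ (σ.injective (hh.trans h0.symm))
              · intro hh
                have := σ.injective (hh.trans h1.symm)
                exact Fin.succ_ne_zero l (Fin.succ_injective _ this)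
            simp only [this, Finset.prod_const_one, mul_one]
          · have hσ : σ ∉ A := by simp [A, h1]
            rw [if_neg hσ, G1 (σ 1) (fun hh => by
              have := σ.injective (hh.trans h0.symm)
              exact absurd this (by simp)) h1, map_zero, zero_mul]
        · have hσ : σ ∉ A := by simp [A, h0]
          rw [if_neg hσ, F1 _ h0, map_zero, zero_apply, zero_mul]
      · intro M hM
        rw [hT]
        simp only [Function.comp_apply]
        rw [F0 M hM, map_zero, zero_apply, zero_mul]
    rw [hJ]
    simp only [e1]
    rw [Finset.sum_ite_mem]
    simp
  refine HasAP.of_retract_smul (X := XX 𝕜 G) J Q (A.card : 𝕜) hA (fun S => ?_) h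
  ext N : 2
  ext a b
  change (Q (J S)) N a b = (A.card : 𝕜) * S N a b
  rw [hQ, hq, key]

end B3

section B4
variable {𝕜 : Type*} [RCLike 𝕜]

theorem embed (p : ℝ≥0∞) [Fact (1 ≤ p)] (hq : 0 < p.toReal) (I : ℕ → Type) [∀ N, Fintype (I N)] :
    ∃ (e : ∀ N, (I N → 𝕜) →ₗ[𝕜] lp (fun _ : ℕ => 𝕜) p) (ρ : ∀ N, lp (fun _ : ℕ => 𝕜) p →ₗ[𝕜] (I N → 𝕜)),
      (∀ N c, ‖e N c‖ ^ p.toReal = ∑ x, ‖c x‖ ^ p.toReal) ∧ (∀ N c, ρ N (e N c) = c) ∧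
      (∀ M N c, M ≠ N → ρ M (e N c) = 0) ∧
      ∀ v, ∀ F : Finset ℕ, ∑ N ∈ F, ∑ x, ‖ρ N v x‖ ^ p.toReal ≤ ‖v‖ ^ p.toReal := by
  classical
  obtain ⟨enc, henc⟩ := Countable.exists_injective_nat (Σ N, I N)
  let e : ∀ N, (I N → 𝕜) →ₗ[𝕜] lp (fun _ : ℕ => 𝕜) p := fun N =>
    { toFun := fun c => ∑ x, lp.single p (enc ⟨N, x⟩) (c x)
      map_add' := by
        intro c c'
        rw [← Finset.sum_add_distrib]
        refine Finset.sum_congr rfl fun x _ => ?_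
        rw [Pi.add_apply, lp.single_add]
      map_smul' := by
        intro r c
        rw [Finset.smul_sum]
        refine Finset.sum_congr rfl fun x _ => ?_
        rw [Pi.smul_apply, lp.single_smul]
        rfl }
  let ρ : ∀ N, lp (fun _ : ℕ => 𝕜) p →ₗ[𝕜] (I N → 𝕜) := fun N =>
    { toFun := fun v x => v (enc ⟨N, x⟩)
      map_add' := fun _ _ => rfl
      map_smul' := fun _ _ => rfl }
  have hρe : ∀ M N c y, ρ M (e N c) y = ∑ x, (if (⟨M, y⟩ : Σ N, I N) = ⟨N, x⟩ then c x else 0) := by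
    intro M N c y
    change (∑ x, lp.single p (enc ⟨N, x⟩) (c x) : lp (fun _ : ℕ => 𝕜) p) (enc ⟨M, y⟩) = _
    rw [lp.coeFn_sum, Finset.sum_apply]
    refine Finset.sum_congr rfl fun x _ => ?_
    rw [lp.single_apply, Pi.single_apply]
    simp only [henc.eq_iff]
  refine ⟨e, ρ, ?_, ?_, ?_, ?_⟩
  · intro N c
    have hinj : Function.Injective (fun x : I N => enc ⟨N, x⟩) := fun x y h => by
      have := henc h
      simpa using this
    let F : ℕ → 𝕜 := Function.extend (fun x : I N => enc ⟨N, x⟩) c 0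
    have hF : ∀ x, F (enc ⟨N, x⟩) = c x := fun x => hinj.extend_apply c 0 x
    have h1 : e N c = ∑ k ∈ Finset.univ.map ⟨_, hinj⟩, lp.single p k (F k) := by
      rw [Finset.sum_map]
      change (∑ x, lp.single p (enc ⟨N, x⟩) (c x) : lp (fun _ : ℕ => 𝕜) p) = _
      refine Finset.sum_congr rfl fun x _ => ?_
      simp only [Function.Embedding.coeFn_mk, hF]
    rw [h1, lp.norm_sum_single hq, Finset.sum_map]
    refine Finset.sum_congr rfl fun x _ => ?_
    simp only [Function.Embedding.coeFn_mk, hF]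
  · intro N c
    funext y
    rw [hρe]
    simp
  · intro M N c h
    funext y
    rw [hρe]
    simp [h]
  · intro v F
    have := lp.sum_rpow_le_norm_rpow hq v ((F.sigma fun N => (Finset.univ : Finset (I N))).map ⟨enc, henc⟩)
    rw [Finset.sum_map, Finset.sum_sigma] at this
    exact this

theorem sum_pow_le {q : ℝ} {n : ℕ} (hq : 0 < q) (hn : q ≤ n) (s : ℕ → ℝ) (hs : ∀ N, 0 ≤ s N) (w : ℝ) (hw : 0 ≤ w)
    (h : ∀ F : Finset ℕ, ∑ N ∈ F, s N ^ q ≤ w ^ q) (F : Finset ℕ) : ∑ N ∈ F, s N ^ n ≤ w ^ n := by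
  have h1 : ∀ N, s N ≤ w := by
    intro N
    have := h {N}
    rw [Finset.sum_singleton] at this
    exact (Real.rpow_le_rpow_iff (hs N) hw hq).1 this
  have h2 : ∀ t : ℝ, 0 ≤ t → t ^ n = t ^ q * t ^ ((n : ℝ) - q) := by
    intro t ht
    rw [← Real.rpow_add_of_nonneg ht hq.le (by linarith), ← Real.rpow_natCast]
    congr 1
    ring
  calc ∑ N ∈ F, s N ^ n ≤ ∑ N ∈ F, s N ^ q * w ^ ((n : ℝ) - q) := by
        refine Finset.sum_le_sum fun N _ => ?_
        rw [h2 _ (hs N)]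
        refine mul_le_mul_of_nonneg_left ?_ (Real.rpow_nonneg (hs N) q)
        exact Real.rpow_le_rpow (hs N) (h1 N) (by linarith)
    _ = (∑ N ∈ F, s N ^ q) * w ^ ((n : ℝ) - q) := by rw [Finset.sum_mul]
    _ ≤ w ^ q * w ^ ((n : ℝ) - q) := mul_le_mul_of_nonneg_right (h F) (Real.rpow_nonneg hw _)
    _ = _ := (h2 w hw).symm

def exL (Ω : Type) : (Ω → 𝕜) →ₗ[𝕜] (Unit ⊕ Ω ⊕ Ω → 𝕜) where
  toFun c := Sum.elim 0 (Sum.elim c 0)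
  map_add' c d := by funext x; rcases x with x | x | x <;> simp
  map_smul' c d := by funext x; rcases x with x | x | x <;> simp

def exR (Ω : Type) : (Ω → 𝕜) →ₗ[𝕜] (Unit ⊕ Ω ⊕ Ω → 𝕜) where
  toFun c := Sum.elim 0 (Sum.elim 0 c)
  map_add' c d := by funext x; rcases x with x | x | x <;> simp
  map_smul' c d := by funext x; rcases x with x | x | x <;> simp

set_option maxHeartbeats 1000000 in
theorem main_aux (p : ℝ≥0∞) [Fact (1 ≤ p)] (hp : 1 < p) (hp' : p < ⊤) (E : Type*) [NormedAddCommGroup E]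
    [NormedSpace 𝕜 E] (A : lp (fun _ : ℕ => 𝕜) p →L[𝕜] E) (B : E →L[𝕜] lp (fun _ : ℕ => 𝕜) p)
    (hBA' : B.comp A = ContinuousLinearMap.id 𝕜 (lp (fun _ : ℕ => 𝕜) p)) (m : ℕ) (hn : p ≤ ((m + 2 : ℕ) : ℝ≥0∞)) :
    ¬ HasAP 𝕜 (HomPoly 𝕜 (m + 2) E 𝕜) := by
  intro hAP
  refine not_AP_GG 𝕜 ?_
  have hBA : ∀ x, B (A x) = x := fun x => by
    have := congrArg (fun T => T x) hBA'
    exact this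
  have hq1 : 1 < p.toReal := by
    have := (ENNReal.toReal_lt_toReal ENNReal.one_ne_top hp'.ne).2 hp
    simpa using this
  have hqn : p.toReal ≤ ((m + 2 : ℕ) : ℝ) := by
    have := (ENNReal.toReal_le_toReal hp'.ne (ENNReal.natCast_ne_top _)).2 hn
    rwa [ENNReal.toReal_natCast] at this
  have hq0 : 0 < p.toReal := by linarith
  obtain ⟨C, hC, hb⟩ := block (𝕜 := 𝕜) p.toReal hq1
  choose Ω hΩ i f hi hf hfi using fun N => hb (GG N)
  obtain ⟨e, ρ, he, hρe, hρe', hρ⟩ := embed (𝕜 := 𝕜) p hq0 (fun N => Unit ⊕ Ω N ⊕ Ω N)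
  set q := p.toReal
  let s : ℕ → E → ℝ := fun N v => (∑ x, ‖ρ N (B v) x‖ ^ q) ^ (1 / q)
  have hsn : ∀ N v, 0 ≤ s N v := fun N v => by positivity
  have hsq : ∀ N v, s N v ^ q = ∑ x, ‖ρ N (B v) x‖ ^ q := by
    intro N v
    rw [← Real.rpow_mul (by positivity), one_div_mul_cancel hq0.ne', Real.rpow_one]
  let C1 := max C 1
  have hC1 : 0 ≤ C1 := le_max_of_le_left hC
  have hC2 : C ≤ C1 := le_max_left _ _
  have hC3 : 1 ≤ C1 := le_max_right _ _
  let K := C1 * (‖A‖ + ‖B‖)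
  have hK : 0 ≤ K := by positivity
  have hpow : ∀ {s t : ℝ}, 0 ≤ s → 0 ≤ t → s ^ q ≤ t ^ q → s ≤ t := fun hs ht h =>
    (Real.rpow_le_rpow_iff hs ht hq0).1 h
  have hAe : ∀ N c t, 0 ≤ t → ∑ x, ‖c x‖ ^ q ≤ (C1 * t) ^ q → ‖A (e N c)‖ ≤ K * t := by
    intro N c t ht h
    have h1 : ‖e N c‖ ≤ C1 * t := hpow (norm_nonneg _) (by positivity) (by rw [he]; exact h)
    calc ‖A (e N c)‖ ≤ ‖A‖ * ‖e N c‖ := A.le_opNorm _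
      _ ≤ (‖A‖ + ‖B‖) * (C1 * t) := by
          gcongr
          exact le_add_of_nonneg_right (norm_nonneg _)
      _ = K * t := by simp only [K]; ring
  have hii : ∀ N a, ∑ ω, ‖i N a ω‖ ^ q ≤ (C1 * ‖a‖) ^ q := fun N a => (hi N a).trans (by gcongr)
  have h0q : (0 : ℝ) ^ q = 0 := Real.zero_rpow hq0.ne'
  have hff : ∀ N v (y : Ω N → 𝕜), (∑ x, ‖y x‖ ^ q ≤ ∑ x, ‖ρ N (B v) x‖ ^ q) → ‖f N y‖ ≤ C1 * s N v := by
    intro N v y h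
    refine (hf N y).trans ?_
    simp only [s]
    gcongr
  refine retract (𝕜 := 𝕜) (E := E) (m := m)
    (fun N => f N ∘ₗ LinearMap.funLeft 𝕜 𝕜 (fun ω => Sum.inr (Sum.inl ω)) ∘ₗ ρ N ∘ₗ B.toLinearMap)
    (fun N => f N ∘ₗ LinearMap.funLeft 𝕜 𝕜 (fun ω => Sum.inr (Sum.inr ω)) ∘ₗ ρ N ∘ₗ B.toLinearMap)
    (fun N => LinearMap.proj (Sum.inl ()) ∘ₗ ρ N ∘ₗ B.toLinearMap)
    (fun N => A.toLinearMap ∘ₗ e N ∘ₗ exL (Ω N) ∘ₗ i N)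
    (fun N => A.toLinearMap ∘ₗ e N ∘ₗ exR (Ω N) ∘ₗ i N)
    (fun N => A (e N (Sum.elim 1 0))) K hK ?_ ?_ ?_ (fun N v => C1 * s N v) (fun N v => mul_nonneg hC1 (hsn N v))
    ?_ ?_ ?_ ?_ ?_ ?_ ?_ ?_ ?_ ?_ ?_ ?_ ?_ hAP
  · intro N a
    refine hAe N _ _ (norm_nonneg _) ?_
    simpa [exL, h0q] using hii N a
  · intro N a
    refine hAe N _ _ (norm_nonneg _) ?_
    simpa [exR, h0q] using hii N a
  · intro N
    have := hAe N (Sum.elim 1 0) 1 zero_le_one (by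
      simp [h0q]
      exact Real.one_le_rpow hC3 hq0.le)
    simpa using this
  · intro N v
    refine hff N v _ ?_
    rw [Fintype.sum_sum_type, Fintype.sum_sum_type]
    have h1 : 0 ≤ ∑ x, ‖ρ N (B v) (Sum.inl x)‖ ^ q := by positivity
    have h2 : 0 ≤ ∑ x, ‖ρ N (B v) (Sum.inr (Sum.inr x))‖ ^ q := by positivity
    simp only [LinearMap.comp_apply, LinearMap.funLeft_apply, ContinuousLinearMap.coe_coe]
    linarith
  · intro N v
    refine hff N v _ ?_
    rw [Fintype.sum_sum_type, Fintype.sum_sum_type]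
    have h1 : 0 ≤ ∑ x, ‖ρ N (B v) (Sum.inl x)‖ ^ q := by positivity
    have h2 : 0 ≤ ∑ x, ‖ρ N (B v) (Sum.inr (Sum.inl x))‖ ^ q := by positivity
    simp only [LinearMap.comp_apply, LinearMap.funLeft_apply, ContinuousLinearMap.coe_coe]
    linarith
  · intro N v
    have : ‖ρ N (B v) (Sum.inl ())‖ ≤ s N v := by
      refine hpow (norm_nonneg _) (hsn N v) ?_
      rw [hsq]
      exact Finset.single_le_sum (f := fun x => ‖ρ N (B v) x‖ ^ q) (fun _ _ => by positivity) (Finset.mem_univ _)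
    calc _ ≤ s N v := this
      _ ≤ C1 * s N v := le_mul_of_one_le_left (hsn N v) hC3
  · intro v F
    have h1 := sum_pow_le hq0 hqn (fun N => s N v) (fun N => hsn N v) ‖B v‖ (norm_nonneg _) (fun F => by
      simp only [hsq]
      exact hρ (B v) F) F
    simp only [mul_pow C1]
    rw [← Finset.mul_sum]
    calc _ ≤ C1 ^ (m + 2) * ‖B v‖ ^ (m + 2) := by gcongr
      _ = (C1 * ‖B v‖) ^ (m + 2) := by rw [mul_pow]
      _ ≤ (K * ‖v‖) ^ (m + 2) := by
          refine pow_le_pow_left₀ (by positivity) ?_ _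
          calc C1 * ‖B v‖ ≤ C1 * (‖B‖ * ‖v‖) := by
                gcongr
                exact B.le_opNorm v
            _ ≤ C1 * ((‖A‖ + ‖B‖) * ‖v‖) := by
                gcongr
                exact le_add_of_nonneg_left (norm_nonneg _)
            _ = _ := by simp only [K]; ring
  · intro N a
    change f N (LinearMap.funLeft 𝕜 𝕜 _ (ρ N (B (A (e N (exL (Ω N) (i N a))))))) = a
    rw [hBA, hρe]
    exact hfi N a
  · intro N a
    change f N (LinearMap.funLeft 𝕜 𝕜 _ (ρ N (B (A (e N (exR (Ω N) (i N a))))))) = 0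
    rw [hBA, hρe]
    exact map_zero (f N)
  · intro N
    change f N (LinearMap.funLeft 𝕜 𝕜 _ (ρ N (B (A (e N _))))) = 0
    rw [hBA, hρe]
    exact map_zero (f N)
  · intro N a
    change f N (LinearMap.funLeft 𝕜 𝕜 _ (ρ N (B (A (e N (exR (Ω N) (i N a))))))) = a
    rw [hBA, hρe]
    exact hfi N a
  · intro N
    change f N (LinearMap.funLeft 𝕜 𝕜 _ (ρ N (B (A (e N _))))) = 0
    rw [hBA, hρe]
    exact map_zero (f N)
  · intro N
    change ρ N (B (A (e N _))) (Sum.inl ()) = 1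
    rw [hBA, hρe]
    rfl
  · intro M N a h
    change f M (LinearMap.funLeft 𝕜 𝕜 _ (ρ M (B (A (e N _))))) = 0
    rw [hBA, hρe' M N _ h, map_zero, map_zero]
  · intro M N a h
    change f M (LinearMap.funLeft 𝕜 𝕜 _ (ρ M (B (A (e N _))))) = 0
    rw [hBA, hρe' M N _ h, map_zero, map_zero]
  · intro M N h
    change f M (LinearMap.funLeft 𝕜 𝕜 _ (ρ M (B (A (e N _))))) = 0
    rw [hBA, hρe' M N _ h, map_zero, map_zero]

end B4

/-- If `1 < p < ∞`, `E` contains a complemented copy of `ℓ_p`, and `n ≥ p`, then `P(ⁿE)` fails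
the approximation property. -/
theorem not_ap_scalarPoly (𝕜 : Type*) [RCLike 𝕜] (p : ℝ≥0∞) [Fact (1 ≤ p)]
    (hp : 1 < p) (hp' : p < ⊤)
    (E : Type*) [NormedAddCommGroup E] [NormedSpace 𝕜 E] [CompleteSpace E]
    (hE : ∃ (A : lp (fun _ : ℕ => 𝕜) p →L[𝕜] E) (B : E →L[𝕜] lp (fun _ : ℕ => 𝕜) p),
      B.comp A = ContinuousLinearMap.id 𝕜 (lp (fun _ : ℕ => 𝕜) p))
    (n : ℕ) (hn : p ≤ (n : ℝ≥0∞)) :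
    ¬ HasAP 𝕜 (HomPoly 𝕜 n E 𝕜) := by
  obtain ⟨A, B, hBA⟩ := hE
  have h2 : 2 ≤ n := by
    have h1 : (1 : ℝ≥0∞) < (n : ℝ≥0∞) := lt_of_lt_of_le hp hn
    have h3 : 1 < n := by exact_mod_cast h1
    omega
  obtain ⟨m, rfl⟩ := Nat.exists_eq_add_of_le' h2
  exact main_aux p hp hp' E A B hBA m hn
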